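/- arXiv:1606.01973 — 5 statements merged into one kernel-verified Lean document; each statement's English description precedes it below -/
import Mathlib

section
/- For every finite family 𝓗 of finite acyclic digraphs there exists a finite simple graph G such that G ⇒ H for every H ∈ 𝓗. -/
/-- An orientation of a simple graph `G`: an asymmetric relation `D` whose
symmetrization is exactly the adjacency relation of `G`. -/
def IsOrientation {V : Type*} (G : SimpleGraph V) (D : V → V → Prop) : Prop :=
  (∀ u v, ¬ (D u v ∧ D v u)) ∧ ∀ u v, G.Adj u v ↔ (D u v ∨ D v u)

/-- A digraph structure on a relation: no loops and no pairs of opposite arcs. -/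
def IsDigraph {W : Type*} (E : W → W → Prop) : Prop :=
  ∀ u v, ¬ (E u v ∧ E v u)

/-- `G ⇒ E`: every orientation `D` of `G` contains an isometric copy of the digraph `E`:
an injective map `f` inducing an isomorphism onto its image, preserving orientations,
such that distances (in the underlying undirected graphs) are preserved. -/
def IsoRamseyArrow {V W : Type*} (G : SimpleGraph V) (E : W → W → Prop) : Prop :=
  ∀ D : V → V → Prop, IsOrientation G D →
    ∃ f : W → V, Function.Injective f ∧
      (∀ u v, E u v ↔ D (f u) (f v)) ∧
      (∀ u v, (SimpleGraph.fromRel E).edist u v = G.edist (f u) (f v))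

/-- A digraph is acyclic if it has no directed cycles, equivalently its transitive
closure is irreflexive. -/
def DigraphAcyclic {W : Type*} (E : W → W → Prop) : Prop :=
  ∀ v, ¬ Relation.TransGen E v v

def Lip1 {A : Type} (G : SimpleGraph A) (h : A → ℤ) : Prop :=
  ∀ a b, G.Adj a b → h a ≤ h b + 1

def GoodEmb {A B : Type} (F : SimpleGraph A) (G : SimpleGraph B) (c : A → B) : Prop :=
  (∀ a b, F.Adj a b → G.Adj (c a) (c b)) ∧
    ∀ f : A → ℤ, Lip1 F f → ∃ h, Lip1 G h ∧ ∀ a, h (c a) = f a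

theorem GoodEmb.comp {A B C : Type} {F : SimpleGraph A} {G : SimpleGraph B} {H : SimpleGraph C}
    {c : A → B} {d : B → C} (hd : GoodEmb G H d) (hc : GoodEmb F G c) :
    GoodEmb F H (fun a => d (c a)) := by
  refine ⟨fun a b hab => hd.1 _ _ (hc.1 _ _ hab), fun f hf => ?_⟩
  obtain ⟨g, hg, hgf⟩ := hc.2 f hf
  obtain ⟨h, hh, hhg⟩ := hd.2 g hg
  exact ⟨h, hh, fun a => by rw [hhg, hgf]⟩

theorem Lip1.walk {A : Type} {G : SimpleGraph A} {h : A → ℤ} (hh : Lip1 G h) {u v : A}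
    (p : G.Walk u v) : h v ≤ h u + p.length := by
  induction p with
  | nil => simp
  | cons hadj p ih =>
    have := hh _ _ hadj.symm
    simp only [SimpleGraph.Walk.length_cons]
    push_cast
    linarith

theorem lip1_trunc {A : Type} (F : SimpleGraph A) (u : A) (n : ℕ) :
    Lip1 F (fun w => ((min (F.edist u w) (n : ℕ∞)).toNat : ℤ)) := by
  intro a b hab
  have h1 : F.edist u a ≤ F.edist u b + 1 := by
    have := F.edist_triangle (u := u) (v := b) (w := a)
    rwa [SimpleGraph.edist_eq_one_iff_adj.2 hab.symm] at this
  have h2 : min (F.edist u a) (n : ℕ∞) ≤ min (F.edist u b) (n : ℕ∞) + 1 := by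
    rcases le_total (F.edist u b) n with h | h
    · rw [min_eq_left h]; exact (min_le_left _ _).trans h1
    · rw [min_eq_right h]; exact (min_le_right _ _).trans le_self_add
  have ha : min (F.edist u a) (n : ℕ∞) ≠ ⊤ :=
    ne_top_of_le_ne_top (ENat.natCast_ne_top n) (min_le_right _ _)
  have hb : min (F.edist u b) (n : ℕ∞) ≠ ⊤ :=
    ne_top_of_le_ne_top (ENat.natCast_ne_top n) (min_le_right _ _)
  obtain ⟨x, hx⟩ := ENat.ne_top_iff_exists.1 ha
  obtain ⟨y, hy⟩ := ENat.ne_top_iff_exists.1 hb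
  simp only [← hx, ← hy] at h2 ⊢
  simp only [ENat.toNat_natCast]
  exact_mod_cast h2

theorem GoodEmb.edist {A B : Type} {F : SimpleGraph A} {G : SimpleGraph B} {c : A → B}
    (hc : GoodEmb F G c) (u v : A) : F.edist u v = G.edist (c u) (c v) := by
  apply le_antisymm
  · by_contra! hlt
    obtain ⟨p, hp⟩ := SimpleGraph.exists_walk_of_edist_ne_top (ne_top_of_lt hlt)
    obtain ⟨h, hh, hhf⟩ := hc.2 _ (lip1_trunc F u (p.length + 1))
    have h1 := hh.walk p
    rw [hhf, hhf] at h1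
    rw [← hp] at hlt
    have h2 : ((p.length + 1 : ℕ) : ℕ∞) ≤ F.edist u v := by
      push_cast
      exact Order.add_one_le_of_lt hlt
    rw [min_eq_right h2] at h1
    simp only [ENat.toNat_natCast] at h1
    simp at h1
  · by_cases ht : F.edist u v = ⊤
    · simp [ht]
    obtain ⟨p, hp⟩ := SimpleGraph.exists_walk_of_edist_ne_top ht
    rw [← hp]
    have := SimpleGraph.edist_le (p.map (⟨c, fun {a b} h => hc.1 a b h⟩ : F →g G))
    simpa using this

/-- Step of the partite construction. -/
theorem partite_step {N : ℕ} {A : Type} [Finite A] (P : SimpleGraph A) (π : A → Fin N)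
    (hπ : ∀ a b, P.Adj a b → π a ≠ π b) (i j : Fin N) (hij : i ≠ j) :
    ∃ (B : Type) (_ : Finite B) (Q : SimpleGraph B) (ρ : B → Fin N),
      (∀ a b, Q.Adj a b → ρ a ≠ ρ b) ∧
      ∀ D : B → B → Prop, IsOrientation Q D → ∃ c : A → B, GoodEmb P Q c ∧
        (∀ a, ρ (c a) = π a) ∧
        ((∀ a b, P.Adj a b → π a = i → π b = j → D (c a) (c b)) ∨
         (∀ a b, P.Adj a b → π a = i → π b = j → D (c b) (c a))) := by
  classical
  let X := {e : A × A // P.Adj e.1 e.2 ∧ π e.1 = i ∧ π e.2 = j}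
  obtain ⟨ι, _, hι⟩ := Combinatorics.Line.exists_mono_in_high_dimension X Bool
  let L := Combinatorics.Line X ι
  have hL : Finite L := Finite.of_injective (fun l : L => l.idxFun) (by
    intro l m h
    exact Combinatorics.Line.ext h)
  let B := Fin N × ((ι → A) ⊕ (L × A))
  let cc : L → A → B := fun M v => (π v,
    if π v = i then Sum.inl (fun t => (M.idxFun t).elim v (fun e => e.1.1))
    else if π v = j then Sum.inl (fun t => (M.idxFun t).elim v (fun e => e.1.2))
    else Sum.inr (M, v))
  let Q : SimpleGraph B :=
    { Adj := fun x y => ∃ M a b, P.Adj a b ∧ x = cc M a ∧ y = cc M b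
      symm := ⟨by
        rintro x y ⟨M, a, b, h, rfl, rfl⟩
        exact ⟨M, b, a, h.symm, rfl, rfl⟩⟩
      loopless := ⟨by
        rintro x ⟨M, a, b, h, hx, hy⟩
        exact hπ a b h (congrArg Prod.fst (hx.symm.trans hy))⟩ }
  refine ⟨B, inferInstance, Q, Prod.fst, ?_, ?_⟩
  · rintro x y ⟨M, a, b, h, rfl, rfl⟩
    exact hπ a b h
  intro D hD
  let C : (ι → X) → Bool := fun w =>
    decide (D (i, Sum.inl fun t => (w t).1.1) (j, Sum.inl fun t => (w t).1.2))
  obtain ⟨l, col, hcol⟩ := hι C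
  have hci : ∀ (M : L) (a : A), π a = i →
      cc M a = (i, Sum.inl (fun t => (M.idxFun t).elim a (fun e => e.1.1))) := by
    intro M a ha
    simp [cc, ha]
  have hcj : ∀ (M : L) (a : A), π a = j →
      cc M a = (j, Sum.inl (fun t => (M.idxFun t).elim a (fun e => e.1.2))) := by
    intro M a ha
    simp [cc, ha, hij.symm]
  have hCl : ∀ e : X, C (l e) = decide (D (cc l e.1.1) (cc l e.1.2)) := by
    intro e
    rw [hci l _ e.2.2.1, hcj l _ e.2.2.2]
    have h1 : (fun t => (l e t).1.1) = (fun t => (l.idxFun t).elim e.1.1 (fun e => e.1.1)) := by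
      funext t
      rw [Combinatorics.Line.coe_apply]
      cases l.idxFun t <;> rfl
    have h2 : (fun t => (l e t).1.2) = (fun t => (l.idxFun t).elim e.1.2 (fun e => e.1.2)) := by
      funext t
      rw [Combinatorics.Line.coe_apply]
      cases l.idxFun t <;> rfl
    simp only [C, h1, h2]
  have hadj : ∀ a b, P.Adj a b → Q.Adj (cc l a) (cc l b) :=
    fun a b h => ⟨l, a, b, h, rfl, rfl⟩
  refine ⟨cc l, ⟨hadj, ?_⟩, fun a => rfl, ?_⟩
  · intro f hf
    obtain ⟨t₀, ht₀⟩ := l.proper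
    let h : B → ℤ := fun x => match x.2 with
      | Sum.inl g => f (g t₀)
      | Sum.inr (M, v) => (M.idxFun t₀).elim (f v) (fun e => f e.1.2)
    have hnone : ∀ (M : L) v, M.idxFun t₀ = none → h (cc M v) = f v := by
      intro M v hM
      by_cases h1 : π v = i
      · rw [hci M v h1]; simp [h, hM]
      by_cases h2 : π v = j
      · rw [hcj M v h2]; simp [h, hM]
      · simp [h, cc, h1, h2, hM]
    have hsome : ∀ (M : L) v e, M.idxFun t₀ = some e →
        h (cc M v) = if π v = i then f e.1.1 else f e.1.2 := by
      intro M v e hM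
      by_cases h1 : π v = i
      · rw [hci M v h1]; simp [h, hM, h1]
      by_cases h2 : π v = j
      · rw [hcj M v h2]; simp [h, hM, h2, hij.symm]
      · simp [h, cc, h1, h2, hM]
    refine ⟨h, ?_, fun a => hnone l a ht₀⟩
    rintro x y ⟨M, a, b, hab, rfl, rfl⟩
    cases hM : M.idxFun t₀ with
    | none => rw [hnone M a hM, hnone M b hM]; exact hf a b hab
    | some e =>
      rw [hsome M a e hM, hsome M b e hM]
      have e1 := hf _ _ e.2.1
      have e2 := hf _ _ e.2.1.symm
      split_ifs <;> linarith
  · cases col with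
    | true =>
      left
      intro a b hab ha hb
      have := (hCl ⟨(a, b), hab, ha, hb⟩).symm.trans (hcol _)
      simpa using this
    | false =>
      right
      intro a b hab ha hb
      have := (hCl ⟨(a, b), hab, ha, hb⟩).symm.trans (hcol _)
      have h2 : ¬ D (cc l a) (cc l b) := by simpa using this
      exact ((hD.2 _ _).1 (hadj a b hab)).resolve_left h2

theorem pullback_orientation {A B : Type} {P : SimpleGraph A} {Q : SimpleGraph B} {c : A → B}
    (hc : GoodEmb P Q c) {D : B → B → Prop} (hD : IsOrientation Q D) :
    IsOrientation P (fun a b => D (c a) (c b)) := by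
  refine ⟨fun u v => hD.1 _ _, fun u v => ?_⟩
  rw [← hD.2, ← SimpleGraph.edist_eq_one_iff_adj, ← SimpleGraph.edist_eq_one_iff_adj, hc.edist]

theorem partite_all {N : ℕ} {A : Type} [Finite A] (P : SimpleGraph A) (π : A → Fin N)
    (hπ : ∀ a b, P.Adj a b → π a ≠ π b) (S : Finset (Fin N × Fin N)) :
    ∃ (B : Type) (_ : Finite B) (Q : SimpleGraph B) (ρ : B → Fin N),
      (∀ a b, Q.Adj a b → ρ a ≠ ρ b) ∧
      ∀ D : B → B → Prop, IsOrientation Q D → ∃ c : A → B, GoodEmb P Q c ∧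
        (∀ a, ρ (c a) = π a) ∧ ∀ p ∈ S, p.1 ≠ p.2 →
        ((∀ a b, P.Adj a b → π a = p.1 → π b = p.2 → D (c a) (c b)) ∨
         (∀ a b, P.Adj a b → π a = p.1 → π b = p.2 → D (c b) (c a))) := by
  classical
  induction S using Finset.induction_on with
  | empty =>
    exact ⟨A, inferInstance, P, π, hπ, fun D hD =>
      ⟨id, ⟨fun a b h => h, fun f hf => ⟨f, hf, fun a => rfl⟩⟩, fun a => rfl, by simp⟩⟩
  | insert p S hp ih =>
    obtain ⟨B, _, Q, ρ, hρ, H⟩ := ih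
    by_cases hne : p.1 = p.2
    · refine ⟨B, inferInstance, Q, ρ, hρ, fun D hD => ?_⟩
      obtain ⟨c, hc, hc2, hc3⟩ := H D hD
      refine ⟨c, hc, hc2, fun q hq hq2 => ?_⟩
      rcases Finset.mem_insert.1 hq with rfl | hq
      · exact absurd hne hq2
      · exact hc3 q hq hq2
    · obtain ⟨B', _, Q', ρ', hρ', H'⟩ := partite_step Q ρ hρ p.1 p.2 hne
      refine ⟨B', inferInstance, Q', ρ', hρ', fun D hD => ?_⟩
      obtain ⟨d, hd, hd2, hd3⟩ := H' D hD
      obtain ⟨c, hc, hc2, hc3⟩ := H _ (pullback_orientation hd hD)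
      refine ⟨fun a => d (c a), hd.comp hc, fun a => by rw [hd2, hc2], fun q hq hq2 => ?_⟩
      rcases Finset.mem_insert.1 hq with rfl | hq
      · refine hd3.imp ?_ ?_
        · intro h a b hab ha hb
          exact h _ _ (hc.1 _ _ hab) (by rw [hc2, ha]) (by rw [hc2, hb])
        · intro h a b hab ha hb
          exact h _ _ (hc.1 _ _ hab) (by rw [hc2, ha]) (by rw [hc2, hb])
      · exact hc3 q hq hq2

theorem exists_source {W : Type} [Finite W] {E : W → W → Prop} (hE : DigraphAcyclic E)
    (A : Finset W) (hA : A.Nonempty) : ∃ u ∈ A, ∀ v ∈ A, ¬ E v u := by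
  have : IsTrans W (Relation.TransGen E) := ⟨fun _ _ _ => Relation.TransGen.trans⟩
  have : Std.Irrefl (Relation.TransGen E) := ⟨hE⟩
  have wf := Finite.wellFounded_of_trans_of_irrefl (Relation.TransGen E)
  obtain ⟨u, hu, h⟩ := wf.has_min (A : Set W) (by simpa using hA)
  exact ⟨u, hu, fun v hv hvu => h v hv (Relation.TransGen.single hvu)⟩

theorem tournament_embed {W : Type} [Finite W] {E : W → W → Prop} (hE : DigraphAcyclic E)
    {α : Type} (T : α → α → Prop) (hT : ∀ i j, i ≠ j → T i j ∨ T j i)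
    (n : ℕ) : ∀ (A : Finset W), A.card = n → ∀ S : Finset α, 2 ^ n ≤ S.card →
      ∃ f : W → α, (∀ a ∈ A, f a ∈ S) ∧ Set.InjOn f A ∧
        ∀ a ∈ A, ∀ b ∈ A, E a b → T (f a) (f b) := by
  classical
  have hE' : DigraphAcyclic (Function.swap E) := by
    intro v hv
    exact hE v (Relation.transGen_swap.1 hv)
  have hirr : ∀ v, ¬ E v v := fun v h => hE v (Relation.TransGen.single h)
  induction n with
  | zero =>
    intro A hA S hS
    have hS' : S.Nonempty := Finset.card_pos.1 (by simpa using hS)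
    obtain ⟨s, hs⟩ := hS'
    rw [Finset.card_eq_zero] at hA
    subst hA
    exact ⟨fun _ => s, by simp, by simp, by simp⟩
  | succ n ih =>
    intro A hA S hS
    have hAne : A.Nonempty := Finset.card_pos.1 (by omega)
    have hSne : S.Nonempty := Finset.card_pos.1 (lt_of_lt_of_le (by positivity) hS)
    obtain ⟨s, hs⟩ := hSne
    let S1 := (S.erase s).filter (fun x => T s x)
    let S2 := (S.erase s).filter (fun x => ¬ T s x)
    have hcard : S1.card + S2.card = (S.erase s).card :=
      Finset.card_filter_add_card_filter_not _
    rw [Finset.card_erase_of_mem hs] at hcard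
    have hpow : 2 ^ (n + 1) = 2 ^ n + 2 ^ n := by ring
    -- common extension argument
    have key : ∀ (u : W) (S' : Finset α), u ∈ A → S' ⊆ S.erase s → 2 ^ n ≤ S'.card →
        (∀ v ∈ A, v ≠ u → ∀ x ∈ S', (E u v → T s x) ∧ (E v u → T x s)) →
        ∃ f : W → α, (∀ a ∈ A, f a ∈ S) ∧ Set.InjOn f A ∧
          ∀ a ∈ A, ∀ b ∈ A, E a b → T (f a) (f b) := by
      intro u S' hu hS' hc hx
      obtain ⟨f, hf1, hf2, hf3⟩ := ih (A.erase u) (by rw [Finset.card_erase_of_mem hu]; omega) S' hc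
      have hm : ∀ a ∈ A, a ≠ u → f a ∈ S' := fun a ha hau =>
        hf1 a (Finset.mem_erase.2 ⟨hau, ha⟩)
      have hm2 : ∀ a ∈ A, a ≠ u → f a ≠ s := fun a ha hau =>
        (Finset.mem_erase.1 (hS' (hm a ha hau))).1
      refine ⟨fun w => if w = u then s else f w, ?_, ?_, ?_⟩
      · intro a ha
        by_cases hau : a = u
        · simpa [hau] using hs
        · simpa [hau] using (Finset.mem_erase.1 (hS' (hm a ha hau))).2
      · intro a ha b hb hab
        by_cases hau : a = u <;> by_cases hbu : b = u
        · rw [hau, hbu]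
        · simp [hau, hbu] at hab
          exact absurd hab.symm (hm2 b hb hbu)
        · simp [hau, hbu] at hab
          exact absurd hab (hm2 a ha hau)
        · simp [hau, hbu] at hab
          exact hf2 (by simpa [hau] using ha) (by simpa [hbu] using hb) hab
      · intro a ha b hb hab
        by_cases hau : a = u <;> by_cases hbu : b = u
        · rw [hau, hbu] at hab
          exact absurd hab (hirr u)
        · simp only [hau, hbu, if_true, if_false]
          exact (hx b hb hbu _ (hm b hb hbu)).1 (hau ▸ hab)
        · simp only [hau, hbu, if_true, if_false]
          exact (hx a ha hau _ (hm a ha hau)).2 (hbu ▸ hab)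
        · simp only [hau, hbu, if_false]
          exact hf3 a (Finset.mem_erase.2 ⟨hau, ha⟩) b (Finset.mem_erase.2 ⟨hbu, hb⟩) hab
    have hor : 2 ^ n ≤ S1.card ∨ 2 ^ n ≤ S2.card := by omega
    rcases hor with h | h
    · obtain ⟨u, hu, hsrc⟩ := exists_source hE A hAne
      refine key u S1 hu (Finset.filter_subset _ _) h fun v hv _ x hx => ⟨fun _ => ?_, fun h => ?_⟩
      · exact (Finset.mem_filter.1 hx).2
      · exact absurd h (hsrc v hv)
    · obtain ⟨u, hu, hsrc⟩ := exists_source hE' A hAne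
      refine key u S2 hu (Finset.filter_subset _ _) h fun v hv _ x hx => ⟨fun h => ?_, fun _ => ?_⟩
      · exact absurd h (hsrc v hv)
      · obtain ⟨hx1, hx2⟩ := Finset.mem_filter.1 hx
        exact (hT s x (Finset.mem_erase.1 hx1).1.symm).resolve_left hx2

theorem stmt1 (m : ℕ) (W : Fin m → Type) [∀ i, Fintype (W i)]
    (E : ∀ i, W i → W i → Prop)
    (hE : ∀ i, IsDigraph (E i)) (hacyc : ∀ i, DigraphAcyclic (E i)) :
    ∃ (V : Type) (_ : Fintype V) (G : SimpleGraph V), ∀ i, IsoRamseyArrow G (E i) := by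
  classical
  let N : ℕ := ∑ k, 2 ^ Fintype.card (W k)
  have hN : ∀ k, 2 ^ Fintype.card (W k) ≤ N := fun k =>
    Finset.single_le_sum (f := fun k => 2 ^ Fintype.card (W k)) (fun _ _ => Nat.zero_le _)
      (Finset.mem_univ k)
  let A := Σ k, (W k → Fin N) × W k
  let π : A → Fin N := fun x => x.2.1 x.2.2
  let P : SimpleGraph A :=
    { Adj := fun x y => ∃ k φ u v, x = ⟨k, φ, u⟩ ∧ y = ⟨k, φ, v⟩ ∧ (E k u v ∨ E k v u) ∧ φ u ≠ φ v
      symm := ⟨by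
        rintro x y ⟨k, φ, u, v, rfl, rfl, h, h'⟩
        exact ⟨k, φ, v, u, rfl, rfl, h.symm, h'.symm⟩⟩
      loopless := ⟨by
        rintro x ⟨k, φ, u, v, hx, hy, h, h'⟩
        exact h' ((congrArg π hx).symm.trans (congrArg π hy))⟩ }
  have hπ : ∀ a b, P.Adj a b → π a ≠ π b := by
    rintro x y ⟨k, φ, u, v, rfl, rfl, h, h'⟩
    exact h'
  obtain ⟨B, hB, Q, ρ, -, H⟩ := partite_all P π hπ Finset.univ
  refine ⟨B, Fintype.ofFinite B, Q, fun k D hD => ?_⟩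
  obtain ⟨c, hc, -, hmono⟩ := H D hD
  let T : Fin N → Fin N → Prop := fun i j => ∀ a b, P.Adj a b → π a = i → π b = j → D (c a) (c b)
  have hT : ∀ i j, i ≠ j → T i j ∨ T j i := by
    intro i j hij
    refine (hmono (i, j) (Finset.mem_univ _) hij).imp id ?_
    intro h a b hab ha hb
    exact h b a hab.symm hb ha
  obtain ⟨φ, -, hφ, hφT⟩ := tournament_embed (hacyc k) T hT _ Finset.univ rfl
    (Finset.univ : Finset (Fin N)) (by simpa using hN k)
  have hφi : Function.Injective φ := by
    intro a b hab
    exact hφ (by simp) (by simp) hab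
  let g : W k → A := fun u => ⟨k, φ, u⟩
  have hgi : Function.Injective g := by
    intro u v huv
    exact hφi (congrArg π huv)
  have hne : ∀ u v, E k u v → u ≠ v := by
    rintro u v h rfl
    exact hE k u u ⟨h, h⟩
  have hgadj : ∀ u v, E k u v → P.Adj (g u) (g v) := fun u v h =>
    ⟨k, φ, u, v, rfl, rfl, Or.inl h, fun h' => hne u v h (hφi h')⟩
  have hg : GoodEmb (SimpleGraph.fromRel (E k)) P g := by
    constructor
    · intro u v huv
      rw [SimpleGraph.fromRel_adj] at huv
      rcases huv.2 with h | h
      · exact hgadj u v h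
      · exact (hgadj v u h).symm
    · intro f hf
      let h : A → ℤ := fun x => if hx : ∃ u, x = g u then f hx.choose else 0
      have hhg : ∀ u, h (g u) = f u := by
        intro u
        have hx : ∃ u', g u = g u' := ⟨u, rfl⟩
        simp only [h, dif_pos hx]
        exact congrArg f (hgi hx.choose_spec.symm)
      refine ⟨h, ?_, hhg⟩
      rintro x y ⟨k', ψ, u, v, rfl, rfl, hE', hψ⟩
      by_cases hkk : (⟨k', ψ⟩ : Σ k, W k → Fin N) = ⟨k, φ⟩
      · obtain ⟨rfl, hψ'⟩ := Sigma.mk.inj_iff.1 hkk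
        obtain rfl := eq_of_heq hψ'
        have h1 : h ⟨k', ψ, u⟩ = f u := hhg u
        have h2 : h ⟨k', ψ, v⟩ = f v := hhg v
        rw [h1, h2]
        refine hf u v ?_
        rw [SimpleGraph.fromRel_adj]
        exact ⟨fun huv => hψ (by rw [huv]), hE'⟩
      · have hz : ∀ w, h ⟨k', ψ, w⟩ = 0 := by
          intro w
          refine dif_neg ?_
          rintro ⟨u', hu'⟩
          exact hkk (congrArg (fun x : A => (⟨x.1, x.2.1⟩ : Σ k, W k → Fin N)) hu')
        rw [hz, hz]
        norm_num
  have hcg := hc.comp hg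
  have hfwd : ∀ u v, E k u v → D (c (g u)) (c (g v)) := fun u v h =>
    hφT u (Finset.mem_univ _) v (Finset.mem_univ _) h (g u) (g v) (hgadj u v h) rfl rfl
  refine ⟨fun u => c (g u), ?_, ?_, hcg.edist⟩
  · intro u v huv
    have := hcg.edist u v
    rw [SimpleGraph.edist_eq_zero_iff.2 huv] at this
    exact SimpleGraph.edist_eq_zero_iff.1 this
  · intro u v
    refine ⟨hfwd u v, fun h => ?_⟩
    have hadj : Q.Adj (c (g u)) (c (g v)) := (hD.2 _ _).2 (Or.inl h)
    have := hcg.edist u v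
    rw [SimpleGraph.edist_eq_one_iff_adj.2 hadj, SimpleGraph.edist_eq_one_iff_adj,
      SimpleGraph.fromRel_adj] at this
    refine this.2.resolve_right fun h' => ?_
    exact hD.1 _ _ ⟨h, hfwd v u h'⟩
end

section
/- For every n ≥ 1 there exists a finite simple graph G with fewer than 2^(2^(n−1)) vertices such that G ⇒ T_n; that is, the isometric Ramsey number of the family of all oriented trees on n vertices satisfies IR(T_n) < 2^(2^(n−1)). -/
/-- An oriented tree: a digraph whose underlying undirected graph is a tree. -/
def IsOrientedTree {W : Type*} (E : W → W → Prop) : Prop :=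
  IsDigraph E ∧ (SimpleGraph.fromRel E).IsTree

/-- `G ⇒ 𝒯ₙ` : `G ⇒ T` for every oriented tree `T` on `n` vertices. -/
def IsoRamseyArrowTrees {V : Type*} (G : SimpleGraph V) (n : ℕ) : Prop :=
  ∀ (W : Type) (_ : Fintype W), Fintype.card W = n →
    ∀ E : W → W → Prop, IsOrientedTree E → IsoRamseyArrow G E

lemma edist_hom_le {A B : Type*} {G : SimpleGraph A} {H : SimpleGraph B} (f : G →g H) (x y : A) :
    H.edist (f x) (f y) ≤ G.edist x y := by
  by_cases h : G.edist x y = ⊤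
  · rw [h]; exact le_top
  · obtain ⟨w, hw⟩ := SimpleGraph.exists_walk_of_edist_ne_top h
    rw [← hw, ← SimpleGraph.Walk.length_map f w]
    exact SimpleGraph.edist_le _

open Classical in
/-- Retraction of a graph onto the complement of a leaf. -/
noncomputable def leafRetr {W : Type*} (v : W) (u : ({v}ᶜ : Set W)) (x : W) : ({v}ᶜ : Set W) :=
  if h : x = v then u else ⟨x, h⟩

lemma leafRetr_self {W : Type*} (v : W) (u : ({v}ᶜ : Set W)) : leafRetr v u v = u := by
  simp [leafRetr]

lemma leafRetr_ne {W : Type*} (v : W) (u : ({v}ᶜ : Set W)) (x : W) (h : x ≠ v) :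
    leafRetr v u x = ⟨x, h⟩ := by
  simp [leafRetr, h]

open Classical in
lemma leaf_edist {W : Type*} (T : SimpleGraph W) (v : W) (u : ({v}ᶜ : Set W))
    (huv : T.Adj v u) (huniq : ∀ w, T.Adj v w → w = u) (x y : W) :
    T.edist x y = (T.induce {v}ᶜ).edist (leafRetr v u x) (leafRetr v u y)
      + if (x = v ↔ y = v) then 0 else 1 := by
  apply le_antisymm
  · have key : ∀ a b : ({v}ᶜ : Set W), T.edist a b ≤ (T.induce {v}ᶜ).edist a b := fun a b =>
      edist_hom_le (SimpleGraph.Embedding.induce ({v}ᶜ : Set W)).toHom a b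
    have h1 : T.edist v u = 1 := SimpleGraph.edist_eq_one_iff_adj.2 huv
    by_cases hx : x = v <;> by_cases hy : y = v
    · subst hx; subst hy; simp
    · subst hx
      rw [leafRetr_self, leafRetr_ne _ _ _ hy]
      simp only [hy, iff_false, not_true, if_false]
      calc T.edist x y ≤ T.edist x u + T.edist u y := SimpleGraph.edist_triangle
        _ ≤ _ := by rw [h1, add_comm]; gcongr; exact key u ⟨y, hy⟩
    · subst hy
      rw [leafRetr_self, leafRetr_ne _ _ _ hx]
      simp only [hx, false_iff, not_true, if_false]
      calc T.edist x y ≤ T.edist x u + T.edist u y := SimpleGraph.edist_triangle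
        _ ≤ _ := by
          rw [SimpleGraph.edist_comm (u := (u : W)) (v := y), h1]; gcongr; exact key ⟨x, hx⟩ u
    · rw [leafRetr_ne _ _ _ hx, leafRetr_ne _ _ _ hy]
      simpa [hx, hy] using key ⟨x, hx⟩ ⟨y, hy⟩
  · let g : T →g (T.induce {v}ᶜ) □ (⊤ : SimpleGraph Prop) :=
      { toFun := fun x => (leafRetr v u x, x = v)
        map_rel' := by
          intro a b hab
          rw [SimpleGraph.boxProd_adj]
          by_cases ha : a = v <;> by_cases hb : b = v
          · subst ha; subst hb; exact absurd hab (T.loopless.irrefl _)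
          · right
            subst ha
            have := huniq b hab
            simp [leafRetr_self, leafRetr_ne _ _ _ hb, hb]
            exact Subtype.ext this.symm
          · right
            subst hb
            have := huniq a hab.symm
            simp [leafRetr_self, leafRetr_ne _ _ _ ha, ha]
            exact Subtype.ext this
          · left
            simp [leafRetr_ne _ _ _ ha, leafRetr_ne _ _ _ hb, ha, hb, hab] }
    have := edist_hom_le g x y
    rw [SimpleGraph.edist_boxProd, SimpleGraph.edist_top] at this
    simpa [g] using this

lemma step_arrow {V : Type} [Fintype V] (G : SimpleGraph V) (n : ℕ) (hn : 1 ≤ n)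
    (h : IsoRamseyArrowTrees G n) :
    IsoRamseyArrowTrees (G □ (⊤ : SimpleGraph (Fin (Fintype.card V + 1)))) (n + 1) := by
  classical
  intro W _ hW E hE D hD
  obtain ⟨hdig, htree⟩ := hE
  set T := SimpleGraph.fromRel E with hT
  have : Nontrivial W := Fintype.one_lt_card_iff_nontrivial.1 (by omega)
  obtain ⟨v, hv⟩ := htree.exists_vert_degree_one_of_nontrivial
  obtain ⟨u0, huv, huniq⟩ := SimpleGraph.degree_eq_one_iff_existsUnique_adj.1 hv
  have hu0 : u0 ≠ v := fun h => T.loopless.irrefl v (h ▸ huv)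
  let u : ({v}ᶜ : Set W) := ⟨u0, hu0⟩
  let E' : ({v}ᶜ : Set W) → ({v}ᶜ : Set W) → Prop := fun a b => E a b
  have hT' : SimpleGraph.fromRel E' = T.induce {v}ᶜ := by
    ext a b
    simp [hT, E', Subtype.ext_iff]
  have htree' : IsOrientedTree E' := by
    refine ⟨fun a b => hdig a b, ?_⟩
    rw [hT']
    exact ⟨htree.1.induce_compl_singleton_of_degree_eq_one hv, htree.2.induce _⟩
  have hcard : Fintype.card ({v}ᶜ : Set W) = n := by
    rw [Fintype.card_compl_set]; simp [hW]
  have hlay : ∀ k, ∃ f : ({v}ᶜ : Set W) → V, Function.Injective f ∧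
      (∀ a b, E' a b ↔ D (f a, k) (f b, k)) ∧
      (∀ a b, (T.induce {v}ᶜ).edist a b = G.edist (f a) (f b)) := by
    intro k
    have := h _ _ hcard E' htree' (fun a b => D (a, k) (b, k))
      ⟨fun a b => hD.1 _ _, fun a b => by rw [← hD.2]; simp⟩
    rwa [hT'] at this
  choose f hinj hor hdist using hlay
  obtain ⟨k0, k1, hk, hkk⟩ := Fintype.exists_ne_map_eq_of_card_lt (fun k => f k u) (by simp)
  have hEor : E v u0 ∨ E u0 v := by
    have := huv
    rw [hT, SimpleGraph.fromRel_adj] at this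
    exact this.2
  obtain ⟨k, k', hne, hE1, hE2⟩ : ∃ k k', k ≠ k' ∧
      (E u0 v ↔ D (f k u, k) (f k u, k')) ∧ (E v u0 ↔ D (f k u, k') (f k u, k)) := by
    have hadj : D (f k0 u, k0) (f k0 u, k1) ∨ D (f k0 u, k1) (f k0 u, k0) := by
      rw [← hD.2]; simp [hk]
    have hn1 := hD.1 (f k0 u, k0) (f k0 u, k1)
    have hn2 := hdig u0 v
    have hkk : f k0 u = f k1 u := hkk
    by_cases hc : E u0 v ↔ D (f k0 u, k0) (f k0 u, k1)
    · exact ⟨k0, k1, hk, hc, by tauto⟩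
    · refine ⟨k1, k0, hk.symm, ?_, ?_⟩ <;> rw [← hkk] <;> tauto
  have hDnot : ∀ p q, ¬ (G □ (⊤ : SimpleGraph (Fin (Fintype.card V + 1)))).Adj p q → ¬ D p q :=
    fun p q hpq hd => hpq ((hD.2 p q).2 (Or.inl hd))
  have hEnot : ∀ x, x ≠ u0 → ¬ E x v ∧ ¬ E v x := by
    intro x hx
    by_cases hxv : x = v
    · subst hxv; have := hdig x x; tauto
    · have h1 : ¬ T.Adj v x := fun ha => hx (huniq x ha)
      rw [hT, SimpleGraph.fromRel_adj] at h1
      have : v ≠ x := fun h => hxv h.symm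
      tauto
  have hu0' : leafRetr v u u0 = u := leafRetr_ne _ _ _ hu0
  let F : W → V × Fin (Fintype.card V + 1) :=
    fun x => (f k (leafRetr v u x), if x = v then k' else k)
  have hFdist : ∀ x y, T.edist x y =
      (G □ (⊤ : SimpleGraph (Fin (Fintype.card V + 1)))).edist (F x) (F y) := by
    intro x y
    rw [leaf_edist T v u huv huniq, SimpleGraph.edist_boxProd, hdist k, SimpleGraph.edist_top]
    congr 1
    by_cases hx : x = v <;> by_cases hy : y = v <;> simp [F, hx, hy, hne, hne.symm]
  have hFinj : Function.Injective F := by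
    intro x y hxy
    rw [← SimpleGraph.edist_eq_zero_iff (G := T), hFdist, hxy, SimpleGraph.edist_self]
  refine ⟨F, hFinj, ?_, hFdist⟩
  have hnadj : ∀ x y, ¬ T.Adj x y → ¬ D (F x) (F y) := by
    intro x y hxy
    apply hDnot
    rwa [← SimpleGraph.edist_eq_one_iff_adj, ← hFdist, SimpleGraph.edist_eq_one_iff_adj]
  intro x y
  by_cases hx : x = v <;> by_cases hy : y = v
  · subst hx; subst hy
    have h1 := hdig y y
    have h2 := hD.1 (F y) (F y)
    tauto
  · subst hx
    by_cases hyu : y = u0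
    · subst hyu
      simpa [F, hy, leafRetr_self, hu0'] using hE2
    · exact iff_of_false (hEnot y hyu).2 (hnadj _ _ fun ha => hyu (huniq y ha))
  · subst hy
    by_cases hxu : x = u0
    · subst hxu
      simpa [F, hx, leafRetr_self, hu0'] using hE1
    · exact iff_of_false (hEnot x hxu).1 (hnadj _ _ fun ha => hxu (huniq x ha.symm))
  · simpa [F, hx, hy, leafRetr_ne, E'] using hor k ⟨x, hx⟩ ⟨y, hy⟩

theorem stmt5 (n : ℕ) (hn : 1 ≤ n) :
    ∃ (V : Type) (_ : Fintype V) (G : SimpleGraph V),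
      Fintype.card V < 2 ^ (2 ^ (n - 1)) ∧ IsoRamseyArrowTrees G n := by
  induction n, hn using Nat.le_induction with
  | base =>
    refine ⟨Unit, inferInstance, ⊥, by simp, ?_⟩
    intro W _ hW E hE D hD
    have : Subsingleton W := Fintype.card_le_one_iff_subsingleton.1 hW.le
    refine ⟨fun _ => (), fun a b _ => Subsingleton.elim a b, fun a b => ?_, fun a b => ?_⟩
    · obtain rfl := Subsingleton.elim a b
      have h1 := hE.1 a a
      have h2 := hD.1 () ()
      tauto
    · obtain rfl := Subsingleton.elim a b
      simp
  | succ n hn ih =>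
    obtain ⟨V, _, G, hc, hG⟩ := ih
    refine ⟨_, inferInstance, _, ?_, step_arrow G n hn hG⟩
    rw [Fintype.card_prod, Fintype.card_fin]
    have : 2 ^ (2 ^ (n + 1 - 1)) = 2 ^ (2 ^ (n - 1)) * 2 ^ (2 ^ (n - 1)) := by
      rw [← pow_add, ← two_mul, ← pow_succ']
      congr 2; omega
    rw [this]
    nlinarith
end

section
/- For every n ≥ 1, every finite simple graph G with chromatic number at least (n² − n + 2)/2 and girth at least 2n−2 satisfies G ⇒ T for every oriented tree T on n vertices. -/
def Col8 {V : Type} (D : V → V → Prop) (S : Set V) (m : ℕ) : Prop :=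
  ∃ c : V → ℕ, (∀ x ∈ S, c x < m) ∧ ∀ x ∈ S, ∀ y ∈ S, D x y → c x ≠ c y

def Acy8 {V : Type} (D : V → V → Prop) (S : Set V) : Prop :=
  ∃ r : V → ℕ, ∀ x ∈ S, ∀ y ∈ S, D x y → r x < r y

def Emb8 {V W : Type} (D : V → V → Prop) (S : Set V) (E : W → W → Prop) : Prop :=
  ∃ f : W → V, Function.Injective f ∧ (∀ w, f w ∈ S) ∧ ∀ u v, E u v → D (f u) (f v)

theorem Col8.union {V : Type} {D : V → V → Prop} {S A : Set V} {a b : ℕ}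
    (hA : Col8 D A a) (hB : Col8 D (S \ A) b) : Col8 D S (a + b) := by
  classical
  obtain ⟨c, hc, hc'⟩ := hA
  obtain ⟨d, hd, hd'⟩ := hB
  refine ⟨fun x => if x ∈ A then c x else a + d x, ?_, ?_⟩
  · intro x hx
    by_cases h : x ∈ A
    · have := hc x h
      simp only [h, if_true]; omega
    · have := hd x ⟨hx, h⟩
      simp only [h, if_false]; omega
  · intro x hx y hy hxy
    by_cases h : x ∈ A <;> by_cases h' : y ∈ A <;> simp only [h, h', if_true, if_false]
    · exact hc' x h y h' hxy
    · have := hc x h; omega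
    · have := hc y h'; omega
    · have := hd' x ⟨hx, h⟩ y ⟨hy, h'⟩ hxy; omega

theorem Acy8.swap {V : Type} [Fintype V] {D : V → V → Prop} {S : Set V}
    (h : Acy8 D S) : Acy8 (fun x y => D y x) S := by
  obtain ⟨r, hr⟩ := h
  refine ⟨fun x => Finset.univ.sup r - r x, ?_⟩
  intro x hx y hy hxy
  have h1 := hr y hy x hx hxy
  have h2 : r x ≤ Finset.univ.sup r := Finset.le_sup (Finset.mem_univ x)
  show _ - _ < _ - _
  omega

/-- in an acyclic set there is a kernel absorbing along in-arcs -/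
theorem Acy8.kernel {V : Type} {D : V → V → Prop} {S : Set V}
    (h : Acy8 D S) : ∃ K ⊆ S, (∀ x ∈ K, ∀ y ∈ K, ¬ D x y) ∧
      ∀ x ∈ S \ K, ∃ y ∈ K, D y x := by
  obtain ⟨r, hr⟩ := h
  have wf : WellFounded (fun x y : V => r x < r y) := (measure r).wf
  let K : V → Prop := wf.fix (C := fun _ => Prop)
    (fun x IH => x ∈ S ∧ ∀ y, ∀ h : r y < r x, y ∈ S → D y x → ¬ IH y h)
  have hK : ∀ x, K x ↔ x ∈ S ∧ ∀ y, r y < r x → y ∈ S → D y x → ¬ K y := by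
    intro x
    have := wf.fix_eq (C := fun _ => Prop)
      (fun x IH => x ∈ S ∧ ∀ y, ∀ h : r y < r x, y ∈ S → D y x → ¬ IH y h) x
    exact iff_of_eq this
  refine ⟨{x | K x}, fun x hx => ((hK x).1 hx).1, ?_, ?_⟩
  · intro x hx y hy hxy
    have hxS := ((hK x).1 hx).1
    have hyS := ((hK y).1 hy).1
    exact ((hK y).1 hy).2 x (hr x hxS y hyS hxy) hxS hxy hx
  · rintro x ⟨hxS, hx⟩
    by_contra hcon
    push Not at hcon
    apply hx
    show K x
    rw [hK]
    exact ⟨hxS, fun y _ _ hyx hy => hcon y hy hyx⟩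

theorem leaf8 {W : Type} [Fintype W] {E : W → W → Prop} (hT : IsOrientedTree E)
    (n : ℕ) (hc : Fintype.card W = n + 2) :
    ∃ u w : W, u ≠ w ∧ IsOrientedTree (fun a b : {x // x ≠ w} => E a b) ∧
      (∀ x, E x w → x = u) ∧ (∀ x, E w x → x = u) := by
  classical
  obtain ⟨hD, hT⟩ := hT
  have : Nontrivial W := Fintype.one_lt_card_iff_nontrivial.1 (by omega)
  obtain ⟨w, hw⟩ := hT.exists_vert_degree_one_of_nontrivial
  have hconn := hT.connected.induce_compl_singleton_of_degree_eq_one hw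
  obtain ⟨u, hu, hu'⟩ := SimpleGraph.degree_eq_one_iff_existsUnique_adj.1 hw
  have hirr : ∀ x, ¬ E x x := fun x hx => hD x x ⟨hx, hx⟩
  refine ⟨u, w, hu.ne', ⟨fun a b => hD a b, ?_⟩, ?_, ?_⟩
  · have e : (SimpleGraph.fromRel (fun a b : {x // x ≠ w} => E a b)) =
        (SimpleGraph.fromRel E).induce ({w}ᶜ : Set W) := by
      ext a b
      rw [SimpleGraph.fromRel_adj, Ne, Subtype.ext_iff]
      exact Iff.rfl
    have h2 : ((SimpleGraph.fromRel E).induce ({w}ᶜ : Set W)).IsTree :=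
      ⟨hconn, hT.isAcyclic.induce _⟩
    rw [← e] at h2
    exact h2
  · intro x hx
    apply hu'
    rw [SimpleGraph.fromRel_adj]
    exact ⟨fun h => hirr x (h ▸ hx), Or.inr hx⟩
  · intro x hx
    apply hu'
    rw [SimpleGraph.fromRel_adj]
    exact ⟨fun h => hirr x (h ▸ hx), Or.inl hx⟩

theorem extend8 {V W : Type} {D : V → V → Prop} {S Q : Set V} {E : W → W → Prop}
    (hD : IsDigraph E) {u w : W} (huw : u ≠ w)
    (h1 : ∀ x, E x w → x = u) (h2 : ∀ x, E w x → x = u)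
    (hQ : Q ⊆ S)
    (hout : E u w → ∀ x ∈ S \ Q, ∃ y ∈ Q, D x y)
    (hin : ¬ E u w → ∀ x ∈ S \ Q, ∃ y ∈ Q, D y x)
    (hf : Emb8 D (S \ Q) (fun a b : {x // x ≠ w} => E a b)) : Emb8 D S E := by
  classical
  obtain ⟨f, hinj, hS, hhom⟩ := hf
  have : ∃ y ∈ Q, (E u w → D (f ⟨u, huw⟩) y) ∧ (E w u → D y (f ⟨u, huw⟩)) := by
    by_cases h : E u w
    · obtain ⟨y, hy, hy'⟩ := hout h _ (hS ⟨u, huw⟩)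
      exact ⟨y, hy, fun _ => hy', fun h' => absurd ⟨h, h'⟩ (hD u w)⟩
    · obtain ⟨y, hy, hy'⟩ := hin h _ (hS ⟨u, huw⟩)
      exact ⟨y, hy, fun h' => absurd h' h, fun _ => hy'⟩
  obtain ⟨y, hy, hy1, hy2⟩ := this
  refine ⟨fun x => if h : x = w then y else f ⟨x, h⟩, ?_, ?_, ?_⟩
  · intro a b hab
    by_cases ha : a = w <;> by_cases hb : b = w <;> simp only [ha, hb, dite_true, dite_false] at hab ⊢
    · exact absurd (hab ▸ hy) (hS ⟨b, hb⟩).2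
    · exact absurd (hab ▸ hy) (hS ⟨a, ha⟩).2
    · simpa using hinj hab
  · intro x
    by_cases h : x = w <;> simp only [h, dite_true, dite_false]
    · exact hQ hy
    · exact (hS _).1
  · intro a b hab
    by_cases ha : a = w
    · subst ha
      have hb := h2 b hab
      subst hb
      simp only [huw, dite_true, dite_false]
      exact hy2 hab
    · by_cases hb : b = w
      · subst hb
        have ha' := h1 a hab
        subst ha'
        simp only [huw, dite_true, dite_false]
        exact hy1 hab
      · simp only [ha, hb, dite_false]
        exact hhom ⟨a, ha⟩ ⟨b, hb⟩ hab

theorem base8 {V W : Type} [Fintype W] {D : V → V → Prop} {S : Set V} {E : W → W → Prop}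
    (hD : IsDigraph E) (hc : Fintype.card W = 1) (hcol : ¬ Col8 D S 0) : Emb8 D S E := by
  have : S.Nonempty := by
    rw [Set.nonempty_iff_ne_empty]
    rintro rfl
    exact hcol ⟨fun _ => 0, by simp, by simp⟩
  obtain ⟨y, hy⟩ := this
  have hs : Subsingleton W := Fintype.card_le_one_iff_subsingleton.1 hc.le
  refine ⟨fun _ => y, fun a b _ => Subsingleton.elim a b, fun _ => hy, ?_⟩
  intro u v huv
  have : v = u := Subsingleton.elim _ _
  subst this
  exact absurd ⟨huv, huv⟩ (hD v v)

theorem acy8_emb {V : Type} [Fintype V] {D : V → V → Prop} (n : ℕ) :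
    ∀ (S : Set V) (W : Type) [Fintype W] (E : W → W → Prop), IsOrientedTree E →
      Fintype.card W = n + 1 → Acy8 D S → ¬ Col8 D S n → Emb8 D S E := by
  classical
  induction n with
  | zero => intro S W _ E hT hc _ hcol; exact base8 hT.1 hc hcol
  | succ n ih =>
    intro S W _ E hT hc hacy hcol
    obtain ⟨u, w, huw, hT', h1, h2⟩ := leaf8 hT n hc
    have key : ∀ K : Set V, K ⊆ S → (∀ x ∈ K, ∀ y ∈ K, ¬ D x y) →
        Emb8 D (S \ K) (fun a b : {x // x ≠ w} => E a b) := by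
      intro K hKS hK
      apply ih _ _ _ hT'
      · simp [hc]
      · obtain ⟨r, hr⟩ := hacy
        exact ⟨r, fun x hx y hy => hr x hx.1 y hy.1⟩
      · intro hcol'
        apply hcol
        rw [add_comm]
        refine Col8.union (A := K) ⟨fun _ => 0, by simp, ?_⟩ hcol'
        intro x hx y hy hxy
        exact absurd hxy (hK x hx y hy)
    by_cases h : E u w
    · obtain ⟨K, hKS, hK, hK'⟩ := hacy.swap.kernel
      exact extend8 hT.1 huw h1 h2 hKS (fun _ => hK') (fun h' => absurd h h')
        (key K hKS (fun x hx y hy => hK y hy x hx))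
    · obtain ⟨K, hKS, hK, hK'⟩ := hacy.kernel
      exact extend8 hT.1 huw h1 h2 hKS (fun h' => absurd h' h) (fun _ => hK') (key K hKS hK)

theorem max8 {V : Type} [Fintype V] {D : V → V → Prop} (hD : ∀ x, ¬ D x x) (S : Set V) :
    ∃ A ⊆ S, Acy8 D A ∧ (∀ x ∈ S \ A, ∃ y ∈ A, D x y) ∧ (∀ x ∈ S \ A, ∃ y ∈ A, D y x) := by
  classical
  obtain ⟨A, hA⟩ := (Set.toFinite {A : Set V | A ⊆ S ∧ Acy8 D A}).exists_maximal
    ⟨∅, Set.empty_subset _, fun _ => 0, by simp⟩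
  obtain ⟨⟨hAS, hacy⟩, hmax⟩ := hA
  have hno : ∀ x ∈ S \ A, ¬ Acy8 D (insert x A) := by
    intro x hx h
    exact hx.2 (hmax ⟨Set.insert_subset hx.1 hAS, h⟩ (Set.subset_insert x A) (Set.mem_insert x A))
  refine ⟨A, hAS, hacy, ?_, ?_⟩
  · intro x hx
    by_contra hcon
    push Not at hcon
    apply hno x hx
    obtain ⟨r, hr⟩ := hacy
    refine ⟨fun y => if y = x then Finset.univ.sup r + 1 else r y, ?_⟩
    intro a ha b hb hab
    have hle : ∀ z, r z ≤ Finset.univ.sup r := fun z => Finset.le_sup (Finset.mem_univ z)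
    rcases ha with rfl | ha <;> rcases hb with rfl | hb
    · exact absurd hab (hD _)
    · exact absurd hab (hcon b hb)
    · have : a ≠ b := fun h => hx.2 (h ▸ ha)
      simp only [this, if_true, if_false]
      have := hle a
      omega
    · have h1 : a ≠ x := fun h => hx.2 (h ▸ ha)
      have h2 : b ≠ x := fun h => hx.2 (h ▸ hb)
      simp only [h1, h2, if_false]
      exact hr a ha b hb hab
  · intro x hx
    by_contra hcon
    push Not at hcon
    apply hno x hx
    obtain ⟨r, hr⟩ := hacy
    refine ⟨fun y => if y = x then 0 else r y + 1, ?_⟩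
    intro a ha b hb hab
    rcases ha with rfl | ha <;> rcases hb with rfl | hb
    · exact absurd hab (hD _)
    · have : b ≠ a := fun h => hx.2 (h ▸ hb)
      simp [this]
    · exact absurd hab (hcon a ha)
    · have h1 : a ≠ x := fun h => hx.2 (h ▸ ha)
      have h2 : b ≠ x := fun h => hx.2 (h ▸ hb)
      simp only [h1, h2, if_false]
      have := hr a ha b hb hab
      omega

theorem main8 {V : Type} [Fintype V] {D : V → V → Prop} (hD : ∀ x, ¬ D x x) (n : ℕ) :
    ∀ (S : Set V) (W : Type) [Fintype W] (E : W → W → Prop), IsOrientedTree E →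
      Fintype.card W = n + 1 → ¬ Col8 D S ((n + 1).choose 2) → Emb8 D S E := by
  classical
  induction n with
  | zero => intro S W _ E hT hc hcol; exact base8 hT.1 hc hcol
  | succ n ih =>
    intro S W _ E hT hc hcol
    obtain ⟨A, hAS, hacy, hout, hin⟩ := max8 hD S
    by_cases hA : Col8 D A (n + 1)
    · obtain ⟨u, w, huw, hT', h1, h2⟩ := leaf8 hT n hc
      refine extend8 hT.1 huw h1 h2 hAS (fun _ => hout) (fun _ => hin) ?_
      apply ih _ _ _ hT'
      · simp [hc]
      · intro hcol'
        apply hcol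
        have : (n + 1 + 1).choose 2 = (n + 1) + (n + 1).choose 2 := by
          rw [Nat.choose_succ_succ' (n + 1) 1]; simp
        rw [this]
        exact hA.union hcol'
    · obtain ⟨f, hf, hfA, hh⟩ := acy8_emb (n + 1) A W E hT hc hacy hA
      exact ⟨f, hf, fun w => hAS (hfA w), hh⟩

/-- two different paths give a short cycle -/
theorem girth8 {V : Type} (G : SimpleGraph V) {u v : V} (p q : G.Walk u v)
    (hp : p.IsPath) (hq : q.IsPath) (hne : p.length ≠ q.length) :
    G.egirth ≤ ((p.length + q.length : ℕ) : ℕ∞) := by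
  classical
  set H : SimpleGraph V := SimpleGraph.fromEdgeSet {e | e ∈ p.edges ++ q.edges} with hH
  have key : ∀ e ∈ p.edges ++ q.edges, e ∈ H.edgeSet := by
    intro e he
    have heG : e ∈ G.edgeSet := by
      rcases List.mem_append.1 he with h | h
      · exact p.edges_subset_edgeSet h
      · exact q.edges_subset_edgeSet h
    rw [hH, SimpleGraph.edgeSet_fromEdgeSet]
    exact ⟨he, fun h => G.not_isDiag_of_mem_edgeSet heG (by simpa using h)⟩
  have hp1 : ∀ e ∈ p.edges, e ∈ H.edgeSet := fun e he => key e (List.mem_append.2 (Or.inl he))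
  have hq1 : ∀ e ∈ q.edges, e ∈ H.edgeSet := fun e he => key e (List.mem_append.2 (Or.inr he))
  have hna : ¬ H.IsAcyclic := by
    intro hac
    have := hac.path_unique ⟨p.transfer H hp1, hp.transfer hp1⟩ ⟨q.transfer H hq1, hq.transfer hq1⟩
    have h3 := congrArg (fun x : H.Path u v => x.1.length) this
    simp at h3
    exact hne h3
  have hex : ∃ (a : V) (c : H.Walk a a), c.IsCycle := by
    by_contra hcon
    push Not at hcon
    exact hna (fun a c => hcon a c)
  obtain ⟨a, c, hc⟩ := hex
  have hle : H ≤ G := by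
    intro x y hxy
    rw [hH, SimpleGraph.fromEdgeSet_adj] at hxy
    rcases List.mem_append.1 hxy.1 with h | h
    · exact p.edges_subset_edgeSet h
    · exact q.edges_subset_edgeSet h
  refine (SimpleGraph.egirth_anti hle).trans ((SimpleGraph.egirth_le_length hc).trans ?_)
  have hsub : c.edges ⊆ p.edges ++ q.edges := by
    intro e he
    have := c.edges_subset_edgeSet he
    rw [hH, SimpleGraph.edgeSet_fromEdgeSet] at this
    exact this.1
  have := (List.subperm_of_subset hc.edges_nodup hsub).length_le
  simp at this
  exact_mod_cast this

theorem stmt8 (n : ℕ) (hn : 1 ≤ n) (V : Type) [Fintype V] (G : SimpleGraph V)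
    (hchi : (((n ^ 2 - n + 2) / 2 : ℕ) : ℕ∞) ≤ G.chromaticNumber)
    (hgirth : ((2 * n - 2 : ℕ) : ℕ∞) ≤ G.egirth)
    (W : Type) [Fintype W] (hcard : Fintype.card W = n)
    (E : W → W → Prop) (hT : IsOrientedTree E) :
    IsoRamseyArrow G E := by
  intro D hO
  obtain ⟨hO1, hO2⟩ := hO
  have hnum : (n ^ 2 - n + 2) / 2 = n.choose 2 + 1 := by
    rw [Nat.choose_two_right, Nat.add_div_right _ (by norm_num), Nat.mul_sub, mul_one, pow_two]
  have hcol : ¬ Col8 D Set.univ (n.choose 2) := by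
    rintro ⟨c, hc, hc'⟩
    have : G.Colorable (n.choose 2) := by
      refine ⟨SimpleGraph.Coloring.mk (fun v => (⟨c v, hc v trivial⟩ : Fin (n.choose 2))) ?_⟩
      intro a b hab heq
      have heq' : c a = c b := congrArg Fin.val heq
      rcases (hO2 a b).1 hab with h | h
      · exact hc' a trivial b trivial h heq'
      · exact hc' b trivial a trivial h heq'.symm
    have h1 := hchi.trans (SimpleGraph.chromaticNumber_le_iff_colorable.2 this)
    rw [hnum] at h1
    have h2 : n.choose 2 + 1 ≤ n.choose 2 := by exact_mod_cast h1
    omega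
  obtain ⟨m, rfl⟩ : ∃ m, n = m + 1 := ⟨n - 1, by omega⟩
  obtain ⟨f, hinj, -, hhom⟩ :=
    main8 (fun x hx => hO1 x x ⟨hx, hx⟩) m Set.univ W E hT hcard hcol
  have hadj : ∀ {a b}, (SimpleGraph.fromRel E).Adj a b → G.Adj (f a) (f b) := by
    intro a b hab
    rw [hO2]
    exact hab.2.imp (hhom a b) (hhom b a)
  let F : SimpleGraph.fromRel E →g G := ⟨f, hadj⟩
  have hdist : ∀ u v, (SimpleGraph.fromRel E).edist u v = G.edist (f u) (f v) := by
    intro u v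
    obtain ⟨p, hp, hpl⟩ := hT.2.connected.exists_path_of_dist u v
    have hpe : (SimpleGraph.fromRel E).edist u v = p.length := by
      rw [hpl, (hT.2.connected u v).coe_dist_eq_edist]
    have hr : G.Reachable (f u) (f v) := ⟨p.map F⟩
    obtain ⟨q, hq, hql⟩ := hr.exists_path_of_dist
    have hqe : G.edist (f u) (f v) = q.length := by
      rw [hql, hr.coe_dist_eq_edist]
    rw [hpe, hqe]
    have hP : (p.map F).IsPath := SimpleGraph.Walk.map_isPath_of_injective hinj hp
    have hle : q.length ≤ p.length := by
      have : G.dist (f u) (f v) ≤ (p.map F).length := SimpleGraph.dist_le _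
      rw [SimpleGraph.Walk.length_map] at this
      omega
    by_contra hne
    have hne' : p.length ≠ q.length := fun h => hne (by rw [h])
    have hg := girth8 G (p.map F) q hP hq (by simpa using hne')
    have h1 := hgirth.trans hg
    have h2 : 2 * (m + 1) - 2 ≤ (p.map F).length + q.length := by exact_mod_cast h1
    rw [SimpleGraph.Walk.length_map] at h2
    have := hp.length_lt
    omega
  refine ⟨f, hinj, fun u v => ⟨hhom u v, fun h => ?_⟩, hdist⟩
  have h1 : (SimpleGraph.fromRel E).Adj u v := by
    rw [← SimpleGraph.edist_eq_one_iff_adj, hdist, SimpleGraph.edist_eq_one_iff_adj, hO2]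
    exact Or.inl h
  rcases h1.2 with h2 | h2
  · exact h2
  · exact absurd ⟨h, hhom v u h2⟩ (hO1 _ _)
end

section
/- Let n ≥ 1 and let G be a finite simple graph. Suppose there are positive real numbers w_1,…,w_{n−1} and d_1,…,d_{n−1} such that for every k with 1 ≤ k ≤ n−1: (1) for every injective tuple (s_1,…,s_{k−1}) of vertices of G and every vertex v not among s_1,…,s_{k−1}, the set Y of vertices y ∉ {v, s_1,…,s_{k−1}} such that {y,v} is an edge of G and dist_{G−v}(y, s_i) ≤ i for some 1 ≤ i ≤ k−1 has cardinality |Y| ≤ d_k; (2) every set W of vertices of G with |W| > w_k spans more than (d_k + k − 1)·w_k edges of G; and (3) w_1 + ⋯ + w_{n−1} < |V_G|. Then G ⇒ T_n. -/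
open Classical in
theorem aux_edge_le {V : Type} [Fintype V] (G : SimpleGraph V) (D : V → V → Prop)
    (hD : IsOrientation G D) (W : Finset V) :
    ({e : Sym2 V | e ∈ G.edgeSet ∧ ∀ x ∈ e, x ∈ (W : Set V)}).ncard ≤
      ∑ u ∈ W, (W.filter (fun y => D u y)).card := by
  have h : {e : Sym2 V | e ∈ G.edgeSet ∧ ∀ x ∈ e, x ∈ (W : Set V)} ⊆
      ((W.sigma (fun u => W.filter (fun y => D u y))).image (fun p => s(p.1, p.2)) :
        Finset (Sym2 V)) := by
    intro e
    induction e using Sym2.ind with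
    | _ a b =>
      rintro ⟨h1, h2⟩
      have ha := h2 a (by simp)
      have hb := h2 b (by simp)
      rw [SimpleGraph.mem_edgeSet, hD.2] at h1
      simp only [Finset.coe_image, Set.mem_image, Finset.mem_coe, Finset.mem_sigma,
        Finset.mem_filter]
      rcases h1 with h1 | h1
      · exact ⟨⟨a, b⟩, ⟨ha, hb, h1⟩, rfl⟩
      · exact ⟨⟨b, a⟩, ⟨hb, ha, h1⟩, Sym2.eq_swap⟩
  calc _ ≤ _ := Set.ncard_le_ncard h (Finset.finite_toSet _)
    _ = _ := Set.ncard_coe_finset _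
    _ ≤ _ := Finset.card_image_le
    _ = _ := by rw [Finset.card_sigma]

open Classical in
theorem aux_two_mul {V : Type} [Fintype V] (G : SimpleGraph V) (D : V → V → Prop)
    (hD : IsOrientation G D) (W : Finset V) :
    (∑ u ∈ W, (W.filter (fun y => D u y)).card) * 2 + W.card ≤ W.card * W.card := by
  have h1 : ∑ u ∈ W, (W.filter (fun y => D u y)).card =
      ∑ u ∈ W, (W.filter (fun y => D y u)).card := by
    simp only [Finset.card_filter]
    exact Finset.sum_comm
  have h2 : ∀ u ∈ W, (W.filter (fun y => D u y)).card + (W.filter (fun y => D y u)).card + 1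
      ≤ W.card := by
    intro u hu
    have hd : Disjoint (W.filter (fun y => D u y)) (W.filter (fun y => D y u)) := by
      rw [Finset.disjoint_filter]
      intro y _ a b
      exact hD.1 _ _ ⟨a, b⟩
    rw [← Finset.card_union_of_disjoint hd]
    apply Nat.succ_le_of_lt
    apply Finset.card_lt_card
    refine ⟨by intro x; simp; tauto, fun h => ?_⟩
    have := h hu
    simp only [Finset.mem_union, Finset.mem_filter] at this
    have := hD.1 u u
    tauto
  have h3 := Finset.sum_le_sum h2
  simp only [Finset.sum_add_distrib, Finset.sum_const, smul_eq_mul, mul_one] at h3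
  rw [← h1] at h3
  omega

open Classical in
theorem aux_caseA {V : Type} [Fintype V] (G : SimpleGraph V) (D : V → V → Prop)
    (hD : IsOrientation G D) (w c : ℝ) (hw : 0 < w) (hc : 0 < c)
    (h2 : ∀ W : Set V, w < (W.ncard : ℝ) →
      c * w < (({e : Sym2 V | e ∈ G.edgeSet ∧ ∀ x ∈ e, x ∈ W}).ncard : ℝ))
    (B : Finset V) (hB : w < B.card)
    (hout : ∀ v ∈ B, ((B.filter (fun y => D v y)).card : ℝ) ≤ c - 1) : False := by
  have hm : ⌊w⌋₊ + 1 ≤ B.card := by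
    have := (Nat.floor_lt hw.le).2 hB
    omega
  obtain ⟨W, hWB, hWc⟩ := Finset.exists_subset_card_eq hm
  have hlt : w < (W.card : ℝ) := by rw [hWc]; push_cast; exact Nat.lt_floor_add_one w
  have hge : (W.card : ℝ) - 1 ≤ w := by
    rw [hWc]; push_cast; linarith [Nat.floor_le hw.le]
  have e1 := h2 (W : Set V) (by rwa [Set.ncard_coe_finset])
  have e2 : (_ : ℝ) ≤ _ := Nat.cast_le.2 (aux_edge_le G D hD W)
  have e3 : (_ : ℝ) ≤ _ := Nat.cast_le.2 (aux_two_mul G D hD W)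
  have e4 : ((∑ u ∈ W, (W.filter (fun y => D u y)).card : ℕ) : ℝ) ≤ W.card * (c - 1) := by
    push_cast
    rw [← nsmul_eq_mul]
    apply Finset.sum_le_card_nsmul
    intro x hx
    refine le_trans ?_ (hout x (hWB hx))
    exact_mod_cast Finset.card_le_card (Finset.filter_subset_filter _ hWB)
  have e5 : c * w < ((∑ u ∈ W, (W.filter (fun y => D u y)).card : ℕ) : ℝ) := lt_of_lt_of_le e1 e2
  generalize ((∑ u ∈ W, (W.filter (fun y => D u y)).card : ℕ)) = f at *
  push_cast at e3
  have hm1 : (1 : ℝ) ≤ W.card := by rw [hWc]; push_cast; linarith [Nat.cast_nonneg (α := ℝ) ⌊w⌋₊]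
  generalize (W.card : ℝ) = m at *
  have e6 : c * (m - 1) ≤ c * w := mul_le_mul_of_nonneg_left hge hc.le
  have e7 : m < c := by nlinarith
  nlinarith

open Classical in
theorem aux_caseB {V : Type} [Fintype V] (G : SimpleGraph V) (D : V → V → Prop)
    (hD : IsOrientation G D) (w c : ℝ) (hw : 0 < w) (hc : 0 < c)
    (h2 : ∀ W : Set V, w < (W.ncard : ℝ) →
      c * w < (({e : Sym2 V | e ∈ G.edgeSet ∧ ∀ x ∈ e, x ∈ W}).ncard : ℝ))
    (B : Finset V) (hB : w + 1 < B.card)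
    (hout : ∀ v ∈ B, ((B.filter (fun y => D v y)).card : ℝ) ≤ c) : False := by
  have hm : ⌊w⌋₊ + 2 ≤ B.card := by
    have := (Nat.floor_lt (by linarith : 0 ≤ w + 1)).2 hB
    rw [Nat.floor_add_one hw.le] at this
    omega
  obtain ⟨W, hWB, hWc⟩ := Finset.exists_subset_card_eq hm
  set a : V → V → ℝ := fun u v => if D u v then 1 else 0 with ha
  have e4 : (∑ u ∈ W, ∑ y ∈ W, a u y) ≤ W.card * c := by
    rw [← nsmul_eq_mul]
    apply Finset.sum_le_card_nsmul
    intro x hx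
    refine le_trans ?_ (hout x (hWB hx))
    simp only [ha]
    rw [Finset.sum_boole]
    exact_mod_cast Finset.card_le_card (Finset.filter_subset_filter _ hWB)
  have key : ∀ x ∈ W, c * w < (∑ u ∈ W, ∑ y ∈ W, a u y) - (∑ y ∈ W, a x y) - (∑ y ∈ W, a y x) := by
    intro x hx
    have hcard : (W.erase x).card = ⌊w⌋₊ + 1 := by
      rw [Finset.card_erase_of_mem hx, hWc]; omega
    have e1 := h2 ((W.erase x : Finset V) : Set V) (by
      rw [Set.ncard_coe_finset, hcard]; push_cast; exact Nat.lt_floor_add_one w)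
    have e2 : (_ : ℝ) ≤ _ := Nat.cast_le.2 (aux_edge_le G D hD (W.erase x))
    refine lt_of_lt_of_le (lt_of_lt_of_le e1 e2) (le_of_eq ?_)
    push_cast
    have hxx : a x x = 0 := by
      simp only [ha]; rw [if_neg]; intro h; exact hD.1 x x ⟨h, h⟩
    have q1 : ∀ u, (((W.erase x).filter (fun y => D u y)).card : ℝ) = (∑ y ∈ W, a u y) - a u x := by
      intro u
      rw [← Finset.sum_erase_add _ _ hx, ← Finset.sum_boole]
      simp [ha]
    simp only [q1]
    rw [Finset.sum_sub_distrib, ← Finset.sum_erase_add W _ hx,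
      ← Finset.sum_erase_add W (fun y => a y x) hx, hxx]
    ring
  have hne : W.Nonempty := by rw [← Finset.card_pos, hWc]; omega
  have s1 := Finset.sum_lt_sum_of_nonempty hne key
  rw [Finset.sum_sub_distrib, Finset.sum_sub_distrib, Finset.sum_const, Finset.sum_const,
    Finset.sum_comm (f := fun x y => a y x), nsmul_eq_mul, nsmul_eq_mul] at s1
  generalize (∑ u ∈ W, ∑ y ∈ W, a u y) = f at *
  have hcc : (W.card : ℝ) = ⌊w⌋₊ + 2 := by rw [hWc]; push_cast; ring
  rw [hcc] at s1 e4
  have hfl := Nat.floor_le hw.le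
  have hf0 : (0 : ℝ) ≤ ⌊w⌋₊ := Nat.cast_nonneg _
  generalize ((⌊w⌋₊ : ℕ) : ℝ) = m at *
  have : m * f ≤ m * ((m + 2) * c) := mul_le_mul_of_nonneg_left e4 hf0
  have : (m + 2) * c * m ≤ (m + 2) * c * w := mul_le_mul_of_nonneg_left hfl (by positivity)
  nlinarith

theorem aux_enum {W : Type} [Fintype W] (H : SimpleGraph W) (hH : H.Connected) (p : W)
    (m : ℕ) (hm : Fintype.card W = m + 1) :
    ∃ e : Fin m → W, Function.Injective e ∧ (∀ i, e i ≠ p) ∧ (∀ u, u ≠ p → ∃ i, e i = u) ∧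
      ∀ i, H.dist p (e i) ≤ (i : ℕ) + 1 := by
  classical
  have hc : Fintype.card {x : W // x ≠ p} = m := by
    rw [Fintype.card_subtype_compl, Fintype.card_subtype_eq, hm]; rfl
  let e0 : Fin m ≃ {x : W // x ≠ p} := (Fintype.equivFinOfCardEq hc).symm
  let g : Fin m → ℕ := fun i => H.dist p (e0 i)
  let σ := Tuple.sort g
  have hmono : Monotone (g ∘ σ) := Tuple.monotone_sort g
  refine ⟨fun i => (e0 (σ i) : W), ?_, fun i => (e0 (σ i)).2, ?_, ?_⟩
  · intro i j hij
    exact σ.injective (e0.injective (Subtype.ext hij))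
  · intro u hu
    exact ⟨σ.symm (e0.symm ⟨u, hu⟩), by simp⟩
  · intro i
    obtain ⟨i, hi⟩ := i
    induction i using Nat.strong_induction_on with
    | _ i ih =>
    by_contra hcon
    simp only [not_le] at hcon
    obtain ⟨q, hq⟩ := hH.exists_walk_length_eq_dist (e0 (σ ⟨i, hi⟩) : W) p
    rw [SimpleGraph.dist_comm] at hq
    have hne := (e0 (σ ⟨i, hi⟩)).2
    generalize hx : (e0 (σ ⟨i, hi⟩) : W) = x at q hcon hne hq
    cases q with
    | nil => exact hne rfl
    | @cons _ u _ h q' =>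
      rw [SimpleGraph.Walk.length_cons] at hq
      have h1 : H.dist p u ≤ q'.length := by
        rw [SimpleGraph.dist_comm]; exact SimpleGraph.dist_le q'
      have h2 : H.dist p x ≤ H.dist p u + 1 := by
        have := hH.dist_triangle (u := p) (v := u) (w := x)
        rwa [SimpleGraph.dist_eq_one_iff_adj.2 h.symm] at this
      have hup : u ≠ p := by
        rintro rfl
        rw [SimpleGraph.dist_self] at h2
        omega
      have hj : e0 (σ (σ.symm (e0.symm ⟨u, hup⟩))) = ⟨u, hup⟩ := by simp
      generalize σ.symm (e0.symm ⟨u, hup⟩) = j at hj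
      have hgj : (g ∘ σ) j = H.dist p u := by
        simp only [Function.comp, g]; rw [hj]
      have hgi : (g ∘ σ) ⟨i, hi⟩ = H.dist p x := by rw [← hx]; rfl
      have hlt : j < ⟨i, hi⟩ := by
        by_contra hge
        have := hmono (not_lt.1 hge)
        omega
      have hlt' : j.1 < i := hlt
      have := ih j.1 hlt' j.2
      simp only [Fin.eta, hj] at this
      omega

theorem aux_leaf_edist {W : Type} (T : SimpleGraph W) (hT : T.IsTree) (t p : W)
    (hp : T.Adj t p) (huniq : ∀ q, T.Adj t q → q = p) (u : W) (hu : u ≠ t) :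
    T.edist t u = T.edist p u + 1 := by
  apply le_antisymm
  · calc T.edist t u ≤ T.edist t p + T.edist p u := SimpleGraph.edist_triangle
      _ = _ := by rw [SimpleGraph.edist_eq_one_iff_adj.2 hp, add_comm]
  · obtain ⟨q, hq⟩ := hT.1.exists_walk_length_eq_edist t u
    rw [← hq]
    cases q with
    | nil => exact absurd rfl hu
    | cons h q' =>
      obtain rfl := huniq _ h
      rw [SimpleGraph.Walk.length_cons]
      push_cast
      gcongr
      exact SimpleGraph.edist_le q'

theorem aux_induce_edist {W : Type} (T : SimpleGraph W) (hT : T.IsTree) (s : Set W)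
    (hs : (T.induce s).Connected) (a b : s) :
    (T.induce s).edist a b = T.edist a b := by
  obtain ⟨q, hq, hq'⟩ := hs.exists_path_of_dist a b
  obtain ⟨r, hr, hr'⟩ := hT.1.exists_path_of_dist (a : W) (b : W)
  have hemb : Function.Injective (SimpleGraph.Embedding.induce (G := T) s).toHom :=
    (SimpleGraph.Embedding.induce (G := T) s).injective
  have hmp : (q.map (SimpleGraph.Embedding.induce (G := T) s).toHom).IsPath :=
    SimpleGraph.Walk.IsPath.map hemb hq
  have := (hT.existsUnique_path (a : W) (b : W)).unique hmp hr
  have h2 := congrArg SimpleGraph.Walk.length this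
  rw [SimpleGraph.Walk.length_map] at h2
  rw [← (hs a b).coe_dist_eq_edist, ← (hT.1 a b).coe_dist_eq_edist, ← hq', ← hr', h2]
  rfl

theorem aux_detour {V : Type} (G : SimpleGraph V) (v y z : V) (hy : y ≠ v) (hz : z ≠ v)
    (hfin : G.edist v z ≠ ⊤) (h : G.edist y z ≤ G.edist v z) :
    (G.induce {x : V | x ≠ v}).edist ⟨y, hy⟩ ⟨z, hz⟩ ≤ G.edist v z := by
  classical
  obtain ⟨q, hq⟩ := SimpleGraph.exists_walk_of_edist_ne_top
    (ne_top_of_le_ne_top hfin h)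
  have hv : v ∉ q.support := by
    intro hv
    have h1 := congrArg SimpleGraph.Walk.length (q.take_spec hv)
    rw [SimpleGraph.Walk.length_append] at h1
    have h2 := SimpleGraph.edist_le (q.dropUntil v hv)
    have h3 : (q.takeUntil v hv).length ≠ 0 := fun h0 =>
      hy (SimpleGraph.Walk.eq_of_length_eq_zero h0)
    have h4 : ((q.length : ℕ) : ℕ∞) ≤ ((q.dropUntil v hv).length : ℕ) := by
      rw [hq]; exact h.trans h2
    have h5 := Nat.cast_le.1 h4
    omega
  have := SimpleGraph.edist_le (q.induce {x : V | x ≠ v} (fun x hx hxv => hv (hxv ▸ hx)))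
  refine this.trans ?_
  have hl := congrArg SimpleGraph.Walk.length
    (q.map_induce (s := {x : V | x ≠ v}) (fun x hx hxv => hv (hxv ▸ hx)))
  rw [SimpleGraph.Walk.length_map] at hl
  rw [hl]
  exact hq.le.trans h

def AuxEmb {V W : Type} (G : SimpleGraph V) (D : V → V → Prop) (U : Finset V)
    (E : W → W → Prop) : Prop :=
  ∃ f : W → V, Function.Injective f ∧ (∀ u, f u ∈ U) ∧
      (∀ u v, E u v ↔ D (f u) (f v)) ∧
      (∀ u v, (SimpleGraph.fromRel E).edist u v = G.edist (f u) (f v))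

theorem aux_flip_rel {W : Type} (E : W → W → Prop) :
    SimpleGraph.fromRel (flip E) = SimpleGraph.fromRel E := by
  ext a b
  simp [flip, or_comm]

theorem aux_flip {V W : Type} (G : SimpleGraph V) (D : V → V → Prop) (U : Finset V)
    (E : W → W → Prop) (h : AuxEmb G (flip D) U (flip E)) : AuxEmb G D U E := by
  obtain ⟨f, h1, h2, h3, h4⟩ := h
  rw [aux_flip_rel] at h4
  exact ⟨f, h1, h2, fun u v => h3 v u, h4⟩

theorem aux_orient_flip {V : Type} (G : SimpleGraph V) (D : V → V → Prop)
    (h : IsOrientation G D) : IsOrientation G (flip D) :=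
  ⟨fun u v hh => h.1 v u hh, fun u v => by rw [h.2]; exact or_comm⟩

theorem aux_extend {V W : Type} (G : SimpleGraph V) (D : V → V → Prop)
    (hD : IsOrientation G D) (U : Finset V) (E : W → W → Prop) (hE : IsOrientedTree E)
    (t p : W) (hpt : p ≠ t) (hEp : E p t)
    (huniq : ∀ q, (SimpleGraph.fromRel E).Adj t q → q = p)
    (f : {x : W // x ≠ t} → V) (hinj : Function.Injective f) (hU : ∀ u, f u ∈ U)
    (hf : ∀ u v, E u.1 v.1 ↔ D (f u) (f v))
    (hdist : ∀ u v : {x : W // x ≠ t}, (SimpleGraph.fromRel E).edist u.1 v.1 = G.edist (f u) (f v))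
    (y : V) (hyU : y ∈ U) (hy : D (f ⟨p, hpt⟩) y) (hynot : ∀ u, f u ≠ y)
    (hfar : ∀ u : {x : W // x ≠ t}, u.1 ≠ p → ¬ G.edist y (f u) ≤ G.edist (f ⟨p, hpt⟩) (f u)) :
    AuxEmb G D U E := by
  classical
  have hadj : (SimpleGraph.fromRel E).Adj t p := by
    rw [SimpleGraph.fromRel_adj]; exact ⟨hpt.symm, Or.inr hEp⟩
  have hyadj : G.Adj y (f ⟨p, hpt⟩) := (hD.2 _ _).2 (Or.inr hy)
  have hd : ∀ u : {x : W // x ≠ t}, (SimpleGraph.fromRel E).edist t u.1 = G.edist y (f u) := by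
    intro u
    rw [aux_leaf_edist _ hE.2 t p hadj huniq u.1 u.2, hdist ⟨p, hpt⟩ u]
    by_cases hup : u.1 = p
    · have : u = ⟨p, hpt⟩ := Subtype.ext hup
      subst this
      rw [SimpleGraph.edist_self, SimpleGraph.edist_eq_one_iff_adj.2 hyadj, zero_add]
    · apply le_antisymm
      · exact Order.add_one_le_of_lt (not_le.1 (hfar u hup))
      · calc _ ≤ G.edist y (f ⟨p, hpt⟩) + G.edist (f ⟨p, hpt⟩) (f u) :=
              SimpleGraph.edist_triangle
          _ = _ := by rw [SimpleGraph.edist_eq_one_iff_adj.2 hyadj, add_comm]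
  have hA : ∀ u : {x : W // x ≠ t}, u.1 ≠ p → ¬ G.Adj y (f u) := by
    intro u hu h
    rw [← SimpleGraph.edist_eq_one_iff_adj, ← hd, SimpleGraph.edist_eq_one_iff_adj] at h
    exact hu (huniq _ h)
  have hA' : ∀ u : {x : W // x ≠ t}, u.1 ≠ p → ¬ E t u.1 ∧ ¬ E u.1 t := by
    intro u hu
    constructor
    · intro h
      exact hu (huniq _ ((SimpleGraph.fromRel_adj _ _ _).2 ⟨u.2.symm, Or.inl h⟩))
    · intro h
      exact hu (huniq _ ((SimpleGraph.fromRel_adj _ _ _).2 ⟨u.2.symm, Or.inr h⟩))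
  have hrel : ∀ u : {x : W // x ≠ t}, (E t u.1 ↔ D y (f u)) ∧ (E u.1 t ↔ D (f u) y) := by
    intro u
    by_cases hup : u.1 = p
    · have : u = ⟨p, hpt⟩ := Subtype.ext hup
      subst this
      have a := hE.1 t p
      have b := hD.1 y (f ⟨p, hpt⟩)
      tauto
    · have a := hA u hup
      have b := hA' u hup
      rw [hD.2] at a
      tauto
  refine ⟨fun x => if h : x = t then y else f ⟨x, h⟩, ?_, ?_, ?_, ?_⟩
  · intro a b hab
    by_cases ha : a = t <;> by_cases hb : b = t <;> simp only [ha, hb, dif_pos, dif_neg, not_false_eq_true] at hab ⊢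
    · exact absurd hab.symm (hynot _)
    · exact absurd hab (hynot _)
    · exact congrArg Subtype.val (hinj hab)
  · intro u
    by_cases hu : u = t
    · simpa [hu] using hyU
    · simpa [hu] using hU _
  · intro a b
    by_cases ha : a = t <;> by_cases hb : b = t <;> simp only [ha, hb, dif_pos, dif_neg, not_false_eq_true]
    · have := hE.1 t t
      have := hD.1 y y
      tauto
    · exact (hrel ⟨b, hb⟩).1
    · exact (hrel ⟨a, ha⟩).2
    · exact hf ⟨a, ha⟩ ⟨b, hb⟩
  · intro a b
    by_cases ha : a = t <;> by_cases hb : b = t <;> simp only [ha, hb, dif_pos, dif_neg, not_false_eq_true]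
    · simp
    · exact hd ⟨b, hb⟩
    · rw [SimpleGraph.edist_comm, hd ⟨a, ha⟩, SimpleGraph.edist_comm]
    · exact hdist ⟨a, ha⟩ ⟨b, hb⟩

theorem aux_star {V W : Type} [Fintype W] (G : SimpleGraph V) (D : V → V → Prop)
    (hD : IsOrientation G D) (U : Finset V) (E : W → W → Prop) (hE : IsOrientedTree E)
    (p : W) (hp : ∀ q, q ≠ p → E p q) (k : ℕ) (hk : Fintype.card W = k + 1)
    (v : V) (hv : v ∈ U) (S : Finset V) (hS : S.card = k) (hSU : S ⊆ U)
    (hSv : ∀ y ∈ S, D v y) (hind : ∀ y ∈ S, ∀ z ∈ S, ¬ G.Adj y z) : AuxEmb G D U E := by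
  classical
  have hc : Fintype.card {x : W // x ≠ p} = Fintype.card S := by
    rw [Fintype.card_subtype_compl, Fintype.card_subtype_eq, hk, Fintype.card_coe, hS]; rfl
  let g : {x : W // x ≠ p} ≃ S := Fintype.equivOfCardEq hc
  have hTadj : ∀ q, q ≠ p → (SimpleGraph.fromRel E).Adj p q := fun q hq =>
    (SimpleGraph.fromRel_adj _ _ _).2 ⟨hq.symm, Or.inl (hp q hq)⟩
  have hGadj : ∀ y ∈ S, G.Adj v y := fun y hy => (hD.2 _ _).2 (Or.inl (hSv y hy))
  have hTn : ∀ a b, a ≠ p → b ≠ p → ¬ (SimpleGraph.fromRel E).Adj a b := by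
    intro a b ha hb hab
    apply hE.2.dist_ne_of_adj p hab
    rw [SimpleGraph.dist_eq_one_iff_adj.2 (hTadj a ha), SimpleGraph.dist_eq_one_iff_adj.2 (hTadj b hb)]
  have hEn : ∀ a b, a ≠ p → b ≠ p → ¬ E a b := by
    intro a b ha hb hab
    apply hTn a b ha hb
    refine (SimpleGraph.fromRel_adj _ _ _).2 ⟨?_, Or.inl hab⟩
    rintro rfl
    exact hE.1 a a ⟨hab, hab⟩
  have hvS : ∀ y ∈ S, y ≠ v := fun y hy h => (hGadj y hy).ne h.symm
  have two : ∀ {X : Type} (H : SimpleGraph X) (a b c : X), a ≠ b → ¬ H.Adj a b → H.Adj c a →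
      H.Adj c b → H.edist a b = 2 := by
    intro X H a b c hab hn h1 h2
    rw [SimpleGraph.edist_eq_two_iff]
    exact ⟨hab, hn, c, by simp [SimpleGraph.mem_commonNeighbors, h1.symm, h2.symm]⟩
  refine ⟨fun x => if h : x = p then v else (g ⟨x, h⟩ : V), ?_, ?_, ?_, ?_⟩
  · intro a b hab
    by_cases ha : a = p <;> by_cases hb : b = p <;> simp only [ha, hb, dif_pos, dif_neg, not_false_eq_true] at hab ⊢
    · exact absurd hab.symm (hvS _ (g _).2)
    · exact absurd hab (hvS _ (g _).2)
    · exact congrArg Subtype.val (g.injective (Subtype.ext hab))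
  · intro u
    by_cases hu : u = p
    · simpa [hu] using hv
    · simpa [hu] using hSU (g _).2
  · intro a b
    by_cases ha : a = p <;> by_cases hb : b = p <;> simp only [ha, hb, dif_pos, dif_neg, not_false_eq_true]
    · have := hE.1 p p
      have := hD.1 v v
      tauto
    · have := hp b hb
      have := hSv _ (g ⟨b, hb⟩).2
      tauto
    · have := hp a ha
      have := hSv _ (g ⟨a, ha⟩).2
      have := hE.1 a p
      have := hD.1 (g ⟨a, ha⟩) v
      tauto
    · have := hEn a b ha hb
      have := hind _ (g ⟨a, ha⟩).2 _ (g ⟨b, hb⟩).2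
      rw [hD.2] at this
      tauto
  · intro a b
    by_cases ha : a = p <;> by_cases hb : b = p <;> simp only [ha, hb, dif_pos, dif_neg, not_false_eq_true]
    · simp
    · rw [SimpleGraph.edist_eq_one_iff_adj.2 (hTadj b hb),
        SimpleGraph.edist_eq_one_iff_adj.2 (hGadj _ (g ⟨b, hb⟩).2)]
    · rw [SimpleGraph.edist_eq_one_iff_adj.2 (hTadj a ha).symm,
        SimpleGraph.edist_eq_one_iff_adj.2 (hGadj _ (g ⟨a, ha⟩).2).symm]
    · by_cases hab : a = b
      · subst hab; simp
      · rw [two _ a b p hab (hTn a b ha hb) (hTadj a ha) (hTadj b hb)]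
        rw [two G _ _ v ?_ (hind _ (g ⟨a, ha⟩).2 _ (g ⟨b, hb⟩).2) (hGadj _ (g ⟨a, ha⟩).2)
          (hGadj _ (g ⟨b, hb⟩).2)]
        intro h
        exact hab (congrArg Subtype.val (g.injective (Subtype.ext h)))

def AuxBad {V : Type} (G : SimpleGraph V) {m : ℕ} (s : Fin m → V) (v : V) : Set V :=
  {y : V | y ≠ v ∧ y ∉ Set.range s ∧ G.Adj y v ∧
    ∃ i : Fin m, ∃ (hy : y ≠ v) (hs : s i ≠ v),
      (G.induce {x : V | x ≠ v}).edist ⟨y, hy⟩ ⟨s i, hs⟩ ≤ (i : ℕ) + 1}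

theorem aux_greedy {V : Type} [Fintype V] (G : SimpleGraph V) (k : ℕ) (d : ℝ) (hd : 0 < d)
    (h1 : ∀ (s : Fin k → V), Function.Injective s → ∀ v : V, v ∉ Set.range s →
      ((AuxBad G s v).ncard : ℝ) ≤ d)
    (v : V) (N : Finset V) (hN : ∀ y ∈ N, G.Adj y v) (hNc : d + k < N.card) (j : ℕ)
    (hj : j ≤ k + 1) :
    ∃ S ⊆ N, S.card = j ∧ ∀ y ∈ S, ∀ z ∈ S, ¬ G.Adj y z := by
  classical
  induction j with
  | zero => exact ⟨∅, by simp, by simp, by simp⟩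
  | succ j ih =>
    obtain ⟨S, hSN, hSc, hS⟩ := ih (by omega)
    obtain ⟨S', hSS', hS'N, hS'c⟩ : ∃ S', S ⊆ S' ∧ S' ⊆ N ∧ S'.card = k := by
      have hkN : k ≤ N.card := by
        have : (k : ℝ) ≤ N.card := by linarith
        exact_mod_cast this
      exact Finset.exists_subsuperset_card_eq hSN (by omega) hkN
    let e : Fin k ≃ S' := (S'.equivFinOfCardEq hS'c).symm
    let s : Fin k → V := fun i => e i
    have hs : Function.Injective s := fun a b h => e.injective (Subtype.ext h)
    have hsr : ∀ x, x ∈ Set.range s ↔ x ∈ S' := by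
      intro x
      constructor
      · rintro ⟨i, rfl⟩; exact (e i).2
      · intro hx; exact ⟨e.symm ⟨x, hx⟩, by simp [s]⟩
    have hvs : v ∉ Set.range s := by
      rw [hsr]; intro hv; exact (hN v (hS'N hv)).ne rfl
    have hY := h1 s hs v hvs
    obtain ⟨y, hyN, hy⟩ : ∃ y ∈ N, y ∉ (AuxBad G s v).toFinset ∪ S' := by
      apply Finset.exists_mem_notMem_of_card_lt_card
      have h2 := Finset.card_union_le (AuxBad G s v).toFinset S'
      rw [hS'c, ← Set.ncard_eq_toFinset_card'] at h2
      have h3 : ((((AuxBad G s v).toFinset ∪ S').card : ℕ) : ℝ) ≤ (AuxBad G s v).ncard + k := by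
        exact_mod_cast h2
      have h4 : ((((AuxBad G s v).toFinset ∪ S').card : ℕ) : ℝ) < N.card := by linarith
      exact_mod_cast h4
    rw [Finset.mem_union, not_or, Set.mem_toFinset] at hy
    obtain ⟨hyB, hyS'⟩ := hy
    have hyv := hN y hyN
    have hno : ∀ z ∈ S', ¬ G.Adj y z := by
      intro z hz hyz
      apply hyB
      obtain ⟨i, rfl⟩ := (hsr z).2 hz
      have hiv : s i ≠ v := (hN _ (hS'N hz)).ne
      refine ⟨hyv.ne, by rwa [hsr], hyv, i, hyv.ne, hiv, ?_⟩
      have : (G.induce {x : V | x ≠ v}).Adj ⟨y, hyv.ne⟩ ⟨s i, hiv⟩ := hyz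
      rw [SimpleGraph.edist_eq_one_iff_adj.2 this]
      exact le_add_self
    refine ⟨insert y S, ?_, ?_, ?_⟩
    · intro x hx
      rcases Finset.mem_insert.1 hx with rfl | hx
      · exact hyN
      · exact hSN hx
    · rw [Finset.card_insert_of_notMem (fun h => hyS' (hSS' h)), hSc]
    · intro a ha b hb
      rcases Finset.mem_insert.1 ha with ha1 | ha1 <;>
        rcases Finset.mem_insert.1 hb with hb1 | hb1
      · rw [ha1, hb1]; exact G.irrefl
      · rw [ha1]; exact hno b (hSS' hb1)
      · rw [hb1]; exact fun h => hno a (hSS' ha1) h.symm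
      · exact hS a ha1 b hb1

open Classical in
theorem aux_step {V W : Type} [Fintype V] [Fintype W] (G : SimpleGraph V) (D : V → V → Prop)
    (hD : IsOrientation G D) (U : Finset V) (E : W → W → Prop) (hE : IsOrientedTree E)
    (k : ℕ) (hk : Fintype.card W = k + 2) (w d r : ℝ) (hw : 0 < w) (hd : 0 < d) (hr : 0 ≤ r)
    (hr1 : 1 ≤ k → 1 ≤ r)
    (h1 : ∀ (s : Fin k → V), Function.Injective s → ∀ v : V, v ∉ Set.range s →
      ((AuxBad G s v).ncard : ℝ) ≤ d)
    (h2 : ∀ W : Set V, w < (W.ncard : ℝ) →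
      (d + k) * w < (({e : Sym2 V | e ∈ G.edgeSet ∧ ∀ x ∈ e, x ∈ W}).ncard : ℝ))
    (hU : r + w < U.card)
    (t p : W) (hEp : E p t)
    (huniq : ∀ q, (SimpleGraph.fromRel E).Adj t q → q = p)
    (hconn : ((SimpleGraph.fromRel E).induce {x : W | x ≠ t}).Connected)
    (ih : ∀ U' : Finset V, r < U'.card →
      AuxEmb G D U' (fun a b : {x : W // x ≠ t} => E a.1 b.1)) :
    AuxEmb G D U E := by
  have hc : 0 < d + k := by positivity
  have hpt : p ≠ t := by rintro rfl; exact hE.1 p p ⟨hEp, hEp⟩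
  by_cases hstar : ∀ q, q ≠ p → E p q
  · -- the star case
    suffices h : ∃ v ∈ U, ∃ S ⊆ U, S.card = k + 1 ∧ (∀ y ∈ S, D v y) ∧
        ∀ y ∈ S, ∀ z ∈ S, ¬ G.Adj y z by
      obtain ⟨v, hv, S, hSU, hSc, hSv, hind⟩ := h
      exact aux_star G D hD U E hE p hstar (k + 1) hk v hv S hSc hSU hSv hind
    rcases Nat.eq_zero_or_pos k with rfl | hk1
    · have e1 := h2 (U : Set V) (by rw [Set.ncard_coe_finset]; linarith)
      have e2 : (_ : ℝ) ≤ _ := Nat.cast_le.2 (aux_edge_le G D hD U)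
      have e3 : (0 : ℝ) < ((∑ u ∈ U, (U.filter (fun y => D u y)).card : ℕ) : ℝ) :=
        lt_of_lt_of_le (lt_trans (by positivity) e1) e2
      have e4 : 0 < ∑ u ∈ U, (U.filter (fun y => D u y)).card := by exact_mod_cast e3
      obtain ⟨u, hu, hu'⟩ := Finset.exists_ne_zero_of_sum_ne_zero e4.ne'
      obtain ⟨y, hy⟩ := Finset.card_ne_zero.1 hu'
      rw [Finset.mem_filter] at hy
      refine ⟨u, hu, {y}, by simpa using hy.1, by simp, by simpa using hy.2, ?_⟩
      simp
    · obtain ⟨v, hv, hvd⟩ : ∃ v ∈ U, d + k < ((U.filter (fun y => D v y)).card : ℝ) := by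
        by_contra hcon
        push Not at hcon
        exact aux_caseB G D hD w (d + k) hw hc h2 U (by linarith [hr1 hk1]) hcon
      obtain ⟨S, hSN, hSc, hS⟩ := aux_greedy G k d hd h1 v (U.filter (fun y => D v y))
        (fun y hy => (hD.2 _ _).2 (Or.inr (Finset.mem_filter.1 hy).2)) hvd (k + 1) le_rfl
      exact ⟨v, hv, S, fun x hx => (Finset.mem_filter.1 (hSN hx)).1, hSc,
        fun x hx => (Finset.mem_filter.1 (hSN hx)).2, hS⟩
  · push Not at hstar
    obtain ⟨q, hqp, hq⟩ := hstar
    have hqt : q ≠ t := by rintro rfl; exact hq hEp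
    set B := U.filter (fun v => ((U.filter (fun y => D v y)).card : ℝ) ≤ d + k - 1) with hB
    have hBw : (B.card : ℝ) ≤ w := by
      by_contra hcon
      refine aux_caseA G D hD w (d + k) hw hc h2 B (not_le.1 hcon) ?_
      intro v hv
      refine le_trans ?_ (Finset.mem_filter.1 hv).2
      exact_mod_cast Finset.card_le_card (Finset.filter_subset_filter _ (Finset.filter_subset _ _))
    have hU' : r < ((U \ B).card : ℝ) := by
      have := Finset.card_sdiff_add_card_eq_card (Finset.filter_subset
        (fun v => ((U.filter (fun y => D v y)).card : ℝ) ≤ d + k - 1) U)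
      rw [← hB] at this
      have h : ((U \ B).card : ℝ) + B.card = U.card := by exact_mod_cast this
      linarith
    obtain ⟨f, hinj, hfU, hf, hdist⟩ := ih (U \ B) hU'
    have hrel : SimpleGraph.fromRel (fun a b : {x : W // x ≠ t} => E a.1 b.1) =
        (SimpleGraph.fromRel E).induce {x : W | x ≠ t} := by
      ext a b
      simp [SimpleGraph.fromRel_adj, Subtype.ext_iff]
    have hdist' : ∀ u v : {x : W // x ≠ t},
        (SimpleGraph.fromRel E).edist u.1 v.1 = G.edist (f u) (f v) := by
      intro u v
      rw [← hdist, hrel]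
      exact (aux_induce_edist _ hE.2 _ hconn u v).symm
    have hcW : Fintype.card {x : W // x ≠ t} = k + 1 := by
      rw [Fintype.card_subtype_compl, Fintype.card_subtype_eq, hk]; rfl
    obtain ⟨e, heinj, hep, hesurj, hed⟩ := aux_enum (W := {x : W // x ≠ t})
      ((SimpleGraph.fromRel E).induce {x : W | x ≠ t}) hconn ⟨p, hpt⟩ k hcW
    let s : Fin k → V := fun i => f (e i)
    have hs : Function.Injective s := hinj.comp heinj
    set v := f ⟨p, hpt⟩ with hv
    have hvs : v ∉ Set.range s := by
      rintro ⟨i, hi⟩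
      exact hep i (hinj hi)
    have hY := h1 s hs v hvs
    have hvU := Finset.mem_sdiff.1 (hfU ⟨p, hpt⟩)
    have hout : d + k - 1 < ((U.filter (fun y => D v y)).card : ℝ) := by
      by_contra hcon
      exact hvU.2 (Finset.mem_filter.2 ⟨hvU.1, not_lt.1 hcon⟩)
    have hqs : f ⟨q, hqt⟩ ∈ Finset.univ.image s := by
      obtain ⟨i, hi⟩ := hesurj ⟨q, hqt⟩ (fun h => hqp (congrArg Subtype.val h))
      exact Finset.mem_image.2 ⟨i, Finset.mem_univ _, by simp only [s, hi]⟩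
    have hcs : (((Finset.univ.image s).erase (f ⟨q, hqt⟩)).card : ℝ) = k - 1 := by
      have h := Finset.card_erase_add_one hqs
      rw [Finset.card_image_of_injective _ hs, Finset.card_univ, Fintype.card_fin] at h
      have h' : (((Finset.univ.image s).erase (f ⟨q, hqt⟩)).card : ℝ) + 1 = k := by
        exact_mod_cast h
      linarith
    obtain ⟨y, hyN, hy⟩ : ∃ y ∈ U.filter (fun y => D v y),
        y ∉ (AuxBad G s v).toFinset ∪ (Finset.univ.image s).erase (f ⟨q, hqt⟩) := by
      apply Finset.exists_mem_notMem_of_card_lt_card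
      have h2 := Finset.card_union_le (AuxBad G s v).toFinset
        ((Finset.univ.image s).erase (f ⟨q, hqt⟩))
      have h3 := (Nat.cast_le (α := ℝ)).2 h2
      rw [← Set.ncard_eq_toFinset_card'] at h3
      rw [Nat.cast_add, hcs] at h3
      have h4 := lt_of_le_of_lt (h3.trans (by linarith : _ ≤ d + k - 1)) hout
      exact_mod_cast h4
    obtain ⟨hyU, hvy⟩ := Finset.mem_filter.1 hyN
    rw [Finset.mem_union, not_or, Set.mem_toFinset] at hy
    obtain ⟨hyB, hyS⟩ := hy
    have hyq : y ≠ f ⟨q, hqt⟩ := by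
      rintro rfl
      exact hq ((hf ⟨p, hpt⟩ ⟨q, hqt⟩).2 hvy)
    have hys : y ∉ Set.range s := by
      rintro ⟨i, hi⟩
      exact hyS (Finset.mem_erase.2 ⟨hyq, Finset.mem_image.2 ⟨i, Finset.mem_univ _, hi⟩⟩)
    have hyv : y ≠ v := by
      rintro rfl
      exact hD.1 _ _ ⟨hvy, hvy⟩
    have hadj : G.Adj y v := (hD.2 _ _).2 (Or.inr hvy)
    refine aux_extend G D hD U E hE t p hpt hEp huniq f hinj
      (fun u => (Finset.mem_sdiff.1 (hfU u)).1) hf hdist' y hyU hvy ?_ ?_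
    · intro u hu
      by_cases hup : u = ⟨p, hpt⟩
      · subst hup; exact hyv hu.symm
      · obtain ⟨i, hi⟩ := hesurj u hup
        exact hys ⟨i, by simp only [s, hi, hu]⟩
    · intro u hup hle
      obtain ⟨i, hi⟩ := hesurj u (fun h => hup (congrArg Subtype.val h))
      have hsi : s i = f u := by simp only [s, hi]
      have hsv : s i ≠ v := fun h => hvs ⟨i, h⟩
      apply hyB
      refine ⟨hyv, hys, hadj, i, hyv, hsv, ?_⟩
      have hreach := hconn ⟨p, hpt⟩ u
      have hval : G.edist v (s i) =
          (((SimpleGraph.fromRel E).induce {x : W | x ≠ t}).dist ⟨p, hpt⟩ (e i) : ℕ) := by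
        rw [hsi, hi, hreach.coe_dist_eq_edist, ← hdist' ⟨p, hpt⟩ u]
        exact (aux_induce_edist _ hE.2 _ hconn ⟨p, hpt⟩ u).symm
      have hdt := aux_detour G v y (s i) hyv hsv (by rw [hval]; exact ENat.natCast_ne_top _)
        (by rw [hsi]; exact hle)
      refine hdt.trans ?_
      rw [hval]
      exact_mod_cast hed i

theorem aux_main (n : ℕ) (V : Type) [Fintype V] (G : SimpleGraph V)
    (w d : ℕ → ℝ)
    (hpos : ∀ k, k + 1 < n → 0 < w (k + 1) ∧ 0 < d (k + 1))
    (h1 : ∀ k, k + 1 < n →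
      ∀ (s : Fin k → V), Function.Injective s →
        ∀ v : V, v ∉ Set.range s → ((AuxBad G s v).ncard : ℝ) ≤ d (k + 1))
    (h2 : ∀ k, k + 1 < n → ∀ W : Set V, w (k + 1) < (W.ncard : ℝ) →
      (d (k + 1) + k) * w (k + 1) <
        (({e : Sym2 V | e ∈ G.edgeSet ∧ ∀ x ∈ e, x ∈ W}).ncard : ℝ)) (k : ℕ) (hkn : k < n) :
    ∀ (D : V → V → Prop), IsOrientation G D → ∀ U : Finset V,
      (∑ i ∈ Finset.range k, w (i + 1)) < (U.card : ℝ) →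
      ∀ (W : Type) (_ : Fintype W), Fintype.card W = k + 1 →
        ∀ E : W → W → Prop, IsOrientedTree E → AuxEmb G D U E := by
  classical
  induction k with
  | zero =>
    intro D hD U hU W _ hW E hE
    have hU' : 0 < U.card := by simpa using hU
    obtain ⟨x, hx⟩ := Finset.card_pos.1 hU'
    have : Subsingleton W := Fintype.card_le_one_iff_subsingleton.1 (by omega)
    refine ⟨fun _ => x, Function.injective_of_subsingleton _, fun _ => hx, ?_, ?_⟩
    · intro u v
      obtain rfl := Subsingleton.elim u v
      have := hE.1 u u
      have := hD.1 x x
      tauto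
    · intro u v
      obtain rfl := Subsingleton.elim u v
      simp
  | succ k ih =>
    have ih := ih (by omega)
    intro D hD U hU W _ hW E hE
    have : Nontrivial W := Fintype.one_lt_card_iff_nontrivial.1 (by omega)
    obtain ⟨t, ht⟩ := hE.2.exists_vert_degree_one_of_nontrivial
    obtain ⟨p, hp, huniq⟩ := SimpleGraph.degree_eq_one_iff_existsUnique_adj.1 ht
    have hconn : ((SimpleGraph.fromRel E).induce {x : W | x ≠ t}).Connected :=
      hE.2.1.induce_compl_singleton_of_degree_eq_one ht
    rw [Finset.sum_range_succ] at hU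
    have hcW : Fintype.card {x : W // x ≠ t} = k + 1 := by
      rw [Fintype.card_subtype_compl, Fintype.card_subtype_eq, hW]; rfl
    have hr : 0 ≤ ∑ i ∈ Finset.range k, w (i + 1) := by
      apply Finset.sum_nonneg
      intro i hi
      rw [Finset.mem_range] at hi
      exact (hpos i (by omega)).1.le
    have hr1 : 1 ≤ k → 1 ≤ ∑ i ∈ Finset.range k, w (i + 1) := by
      intro hk
      have hw1 : 1 ≤ w (0 + 1) := by
        by_contra hlt
        obtain ⟨x, hx⟩ := Finset.card_pos.1 (by
          have : (0 : ℝ) < U.card := by linarith [(hpos k (by omega)).1]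
          exact_mod_cast this)
        have h := h2 0 (by omega) {x} (by simpa using hlt)
        have hemp : {e : Sym2 V | e ∈ G.edgeSet ∧ ∀ y ∈ e, y ∈ ({x} : Set V)} = ∅ := by
          ext e
          induction e using Sym2.ind with
          | _ a b =>
            simp only [SimpleGraph.mem_edgeSet, Set.mem_setOf_eq, Set.mem_empty_iff_false,
              iff_false, not_and]
            intro hab hh
            have ha : a = x := hh a (by simp)
            have hb : b = x := hh b (by simp)
            exact hab.ne (ha.trans hb.symm)
        rw [hemp, Set.ncard_empty] at h
        have := hpos 0 (by omega)
        have : 0 < (d (0 + 1) + ((0 : ℕ) : ℝ)) * w (0 + 1) := by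
          rw [Nat.cast_zero, add_zero]; exact mul_pos this.2 this.1
        rw [Nat.cast_zero] at h this
        linarith
      refine hw1.trans (Finset.single_le_sum (f := fun i => w (i + 1)) ?_ (Finset.mem_range.2 hk))
      intro i hi
      rw [Finset.mem_range] at hi
      exact (hpos i (by omega)).1.le
    have hsub : ∀ E : W → W → Prop, IsOrientedTree E →
        ((SimpleGraph.fromRel E).induce {x : W | x ≠ t}).Connected →
        IsOrientedTree (fun a b : {x : W // x ≠ t} => E a.1 b.1) := by
      intro E hE hconn
      have hrel : SimpleGraph.fromRel (fun a b : {x : W // x ≠ t} => E a.1 b.1) =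
          (SimpleGraph.fromRel E).induce {x : W | x ≠ t} := by
        ext a b
        simp [SimpleGraph.fromRel_adj, Subtype.ext_iff]
      refine ⟨fun u v => hE.1 u.1 v.1, ?_⟩
      rw [hrel]
      exact ⟨hconn, hE.2.2.induce _⟩
    have step : ∀ (D : V → V → Prop), IsOrientation G D → ∀ E : W → W → Prop, IsOrientedTree E →
        E p t → (∀ q, (SimpleGraph.fromRel E).Adj t q → q = p) →
        ((SimpleGraph.fromRel E).induce {x : W | x ≠ t}).Connected → AuxEmb G D U E := by
      intro D hD E hE hEp huniq hconn
      exact aux_step G D hD U E hE k hW (w (k + 1)) (d (k + 1)) _ (hpos k hkn).1 (hpos k hkn).2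
        hr hr1 (h1 k hkn) (h2 k hkn) hU t p hEp huniq hconn
        (fun U' hU' => ih D hD U' hU' _ _ hcW _ (hsub E hE hconn))
    rcases ((SimpleGraph.fromRel_adj _ _ _).1 hp).2 with h | h
    · apply aux_flip
      refine step (flip D) (aux_orient_flip G D hD) (flip E) ⟨fun u v hh => hE.1 v u hh, ?_⟩ h ?_ ?_
      · rw [aux_flip_rel]; exact hE.2
      · rw [aux_flip_rel]; exact huniq
      · rw [aux_flip_rel]; exact hconn
    · exact step D hD E hE h huniq hconn

theorem stmt9 (n : ℕ) (hn : 1 ≤ n) (V : Type) [Fintype V] (G : SimpleGraph V)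
    (w d : ℕ → ℝ)
    (hpos : ∀ k, 1 ≤ k → k ≤ n - 1 → 0 < w k ∧ 0 < d k)
    (h1 : ∀ k, 1 ≤ k → k ≤ n - 1 →
      ∀ (s : Fin (k - 1) → V), Function.Injective s →
        ∀ v : V, v ∉ Set.range s →
          (({y : V | y ≠ v ∧ y ∉ Set.range s ∧ G.Adj y v ∧
              ∃ i : Fin (k - 1), ∃ (hy : y ≠ v) (hs : s i ≠ v),
                (G.induce {x : V | x ≠ v}).edist ⟨y, hy⟩ ⟨s i, hs⟩ ≤ (i : ℕ) + 1}.ncard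
            : ℝ) ≤ d k))
    (h2 : ∀ k, 1 ≤ k → k ≤ n - 1 →
      ∀ W : Set V, w k < (W.ncard : ℝ) →
        (d k + (k : ℝ) - 1) * w k < (({e : Sym2 V | e ∈ G.edgeSet ∧ ∀ x ∈ e, x ∈ W}).ncard : ℝ))
    (h3 : (∑ k ∈ Finset.Icc 1 (n - 1), w k) < (Fintype.card V : ℝ)) :
    IsoRamseyArrowTrees G n := by
  have key := aux_main n V G w d
    (fun k hk => hpos (k + 1) (by omega) (by omega))
    (fun k hk s hs v hv => h1 (k + 1) (by omega) (by omega) s hs v hv)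
    (fun k hk W hW => by
      have := h2 (k + 1) (by omega) (by omega) W hW
      push_cast at this
      rwa [← add_assoc, add_sub_cancel_right] at this)
    (n - 1) (by omega)
  intro W _ hW E hE D hD
  obtain ⟨f, a, _, b, c⟩ := key D hD Finset.univ (by
    rw [Finset.card_univ]
    refine lt_of_le_of_lt (le_of_eq ?_) h3
    rw [← Finset.Ico_add_one_right_eq_Icc, Finset.sum_Ico_eq_sum_range]
    simp [add_comm]) W _ (by omega) E hE
  exact ⟨f, a, b, c⟩
end

section
/- Let n and N be positive integers. Suppose there exist real numbers c, p ∈ (0,1) and C ∈ (1,∞) satisfying: (1) c²·p·N > 3·ln(3N); (2) (1 − C + C·ln C)·p·(1+c)^n·(pN)^{n−2} > (n−1)·ln N + ln(1+c) + ln 3; (3) c²·C²·(1+c)^{2n}·(pN)^{2n−4} > N·ln 2 + ln(3n); (4) (n−1)(n−2)/((1−c)·p) + (2C/(1−c))·(n−1)·(1+c)^n·(pN)^{n−2} < N. Then there exists a finite simple graph G on N vertices such that G ⇒ T_n. -/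
open Finset

/-- `x` is reachable from `w` by a walk of length at most `r` avoiding `u`. -/
def inBall {V : Type*} (G : SimpleGraph V) (u : V) : ℕ → V → V → Prop
  | 0, w, x => w ≠ u ∧ x = w
  | r + 1, w, x => w ≠ u ∧ (x = w ∨ ∃ y, G.Adj w y ∧ inBall G u r y x)

theorem inBall_of_walk {V : Type*} (G : SimpleGraph V) (u : V) {w x : V} (q : G.Walk w x) :
    ∀ r, q.length ≤ r → u ∉ q.support → inBall G u r w x := by
  induction q with
  | nil =>
    intro r _ h
    have h' := h
    simp only [SimpleGraph.Walk.support_nil, List.mem_singleton] at h'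
    cases r with
    | zero => exact ⟨fun e => h' e.symm, rfl⟩
    | succ r => exact ⟨fun e => h' e.symm, Or.inl rfl⟩
  | cons hadj q ih =>
    intro r hr h
    simp only [SimpleGraph.Walk.support_cons, List.mem_cons, not_or] at h
    simp only [SimpleGraph.Walk.length_cons] at hr
    cases r with
    | zero => omega
    | succ r => exact ⟨fun e => h.1 e.symm, Or.inr ⟨_, hadj, ih r (by omega) h.2⟩⟩

/-- number of edges inside `A` -/
noncomputable def edgesIn {V : Type*} (G : SimpleGraph V) (A : Finset V) : ℕ := by
  classical
  exact ((A.offDiag.image (fun z : V × V => s(z.1, z.2))).filter (fun e => e ∈ G.edgeSet)).card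

open Classical in
theorem edgesIn_le {V : Type*} (G : SimpleGraph V) (A : Finset V) (Q : V → V → Prop)
    (hQ : ∀ u v, G.Adj u v → (Q u v ∨ Q v u)) :
    edgesIn G A ≤ ∑ v ∈ A, (A.filter (fun x => Q v x)).card := by
  unfold edgesIn
  rw [← Finset.card_sigma]
  have : ((A.offDiag.image (fun z : V × V => s(z.1, z.2))).filter (fun e => e ∈ G.edgeSet)) ⊆
      (A.sigma (fun v => A.filter (fun x => Q v x))).image
        (fun z : (_ : V) × V => s(z.1, z.2)) := by
    intro e he
    simp only [mem_filter, mem_image, mem_offDiag, Prod.exists] at he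
    obtain ⟨⟨x, y, ⟨hx, hy, _⟩, rfl⟩, hadj⟩ := he
    rw [SimpleGraph.mem_edgeSet] at hadj
    simp only [mem_image, mem_sigma, mem_filter]
    rcases hQ x y hadj with h | h
    · exact ⟨⟨x, y⟩, ⟨hx, hy, h⟩, rfl⟩
    · exact ⟨⟨y, x⟩, ⟨hy, hx, h⟩, Sym2.eq_swap⟩
  exact (Finset.card_le_card this).trans Finset.card_image_le

open Classical in
theorem low_card {V : Type*} (G : SimpleGraph V) (a : ℕ) (ha : 1 ≤ a) (D : ℝ)
    (H2 : ∀ A : Finset V, A.card = a → D * a ≤ edgesIn G A) (Q : V → V → Prop)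
    (hQ : ∀ u v, G.Adj u v → (Q u v ∨ Q v u)) (S : Finset V) :
    (S.filter (fun v => ((S.filter (fun x => Q v x)).card : ℝ) < D)).card ≤ a - 1 := by
  by_contra hcon
  obtain ⟨A, hA, hAc⟩ := Finset.exists_subset_card_eq (s := S.filter (fun v => ((S.filter (fun x => Q v x)).card : ℝ) < D)) (n := a) (by omega)
  have h1 := H2 A hAc
  have h2 := edgesIn_le G A Q hQ
  have h3 : (∑ v ∈ A, ((A.filter (fun x => Q v x)).card : ℝ)) < ∑ v ∈ A, D := by
    apply Finset.sum_lt_sum_of_nonempty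
    · rw [← Finset.card_pos]; omega
    · intro v hv
      have := hA hv
      rw [mem_filter] at this
      refine lt_of_le_of_lt ?_ this.2
      exact_mod_cast Finset.card_le_card (Finset.filter_subset_filter _ (hA.trans (Finset.filter_subset _ _)))
  rw [Finset.sum_const, hAc, nsmul_eq_mul] at h3
  have h4 : (edgesIn G A : ℝ) ≤ ∑ v ∈ A, ((A.filter (fun x => Q v x)).card : ℝ) := by
    exact_mod_cast h2
  nlinarith

theorem path_length_eq_dist {W : Type*} {T : SimpleGraph W} (hT : T.IsTree) {x y : W}
    (q : T.Walk x y) (hq : q.IsPath) : q.length = T.dist x y := by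
  obtain ⟨q', hq', hl⟩ := hT.connected.exists_path_of_dist x y
  have := (hT.isAcyclic.subsingleton_path x y).elim ⟨q, hq⟩ ⟨q', hq'⟩
  have h2 : q = q' := congrArg Subtype.val this
  rw [h2, hl]

theorem induce_dist {W : Type*} {T : SimpleGraph W} (hT : T.IsTree) (s : Set W)
    (hs : (T.induce s).Connected) (x y : s) : (T.induce s).dist x y = T.dist x y := by
  obtain ⟨q, hq, hl⟩ := hs.exists_path_of_dist x y
  have h1 := path_length_eq_dist hT (q.map (SimpleGraph.Embedding.induce s).toHom)
    (SimpleGraph.Walk.IsPath.map (SimpleGraph.Embedding.induce (G := T) s).injective hq)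
  rw [SimpleGraph.Walk.length_map] at h1
  rw [← hl, h1]
  rfl

theorem rank_exists {W : Type*} [Fintype W] (k : ℕ) (hk : Fintype.card W = k) (δ : W → ℕ)
    (hgap : ∀ w t, t < δ w → ∃ w', δ w' = t) :
    ∃ e : Fin k ≃ W, ∀ i, δ (e i) ≤ i := by
  let e0 : Fin k ≃ W := (Fintype.equivFinOfCardEq hk).symm
  let e : Fin k ≃ W := (Tuple.sort (δ ∘ e0)).trans e0
  have hmono : Monotone (δ ∘ e) := Tuple.monotone_sort (δ ∘ e0)
  refine ⟨e, ?_⟩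
  have key : ∀ j (hj : j < k), δ (e ⟨j, hj⟩) ≤ j := by
    intro j
    induction j with
    | zero =>
      intro hj
      by_contra hcon
      obtain ⟨w', hw'⟩ := hgap (e ⟨0, hj⟩) 0 (by omega)
      have := hmono (show (⟨0, hj⟩ : Fin k) ≤ e.symm w' from by
        rw [Fin.le_def]; exact Nat.zero_le _)
      simp only [Function.comp, Equiv.apply_symm_apply] at this
      omega
    | succ j ih =>
      intro hj
      have hi := ih (by omega)
      by_contra hcon
      obtain ⟨w', hw'⟩ := hgap (e ⟨j + 1, hj⟩) (j + 1) (by omega)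
      rcases le_or_gt (e.symm w').1 j with h | h
      · have := hmono (show e.symm w' ≤ (⟨j, by omega⟩ : Fin k) from by rw [Fin.le_def]; exact h)
        simp only [Function.comp, Equiv.apply_symm_apply] at this
        omega
      · have := hmono (show (⟨j + 1, hj⟩ : Fin k) ≤ e.symm w' from by rw [Fin.le_def]; exact h)
        simp only [Function.comp, Equiv.apply_symm_apply] at this
        omega
  intro i
  exact key i.1 i.2

theorem dist_gap {W : Type*} {T : SimpleGraph W} (hT : T.Connected) (u w : W) (t : ℕ)
    (ht : t < T.dist u w) : ∃ w', T.dist u w' = t := by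
  obtain ⟨q, hq⟩ := hT.exists_walk_length_eq_dist u w
  refine ⟨q.getVert t, ?_⟩
  have h1 := SimpleGraph.dist_le (q.take t)
  have h2 := SimpleGraph.dist_le (q.drop t)
  have h3 := hT.dist_triangle (u := u) (v := q.getVert t) (w := w)
  rw [SimpleGraph.Walk.take_length] at h1
  rw [SimpleGraph.Walk.drop_length] at h2
  omega

theorem leaf_dist {W : Type*} {T : SimpleGraph W} (hT : T.Connected) {u v w : W}
    (huv : T.Adj v u) (hl : ∀ y, T.Adj v y → y = u) (hw : w ≠ v) :
    T.dist v w = T.dist u w + 1 := by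
  have h3 := hT.dist_triangle (u := v) (v := u) (w := w)
  rw [SimpleGraph.dist_eq_one_iff_adj.mpr huv] at h3
  obtain ⟨q, hq⟩ := hT.exists_walk_length_eq_dist v w
  cases q with
  | nil => exact absurd rfl hw
  | cons hadj q =>
    have := hl _ hadj
    subst this
    have := SimpleGraph.dist_le q
    simp only [SimpleGraph.Walk.length_cons] at hq
    omega

theorem new_dist {V : Type*} (G : SimpleGraph V) {y u x : V} (r : ℕ) (hux : G.Adj u x)
    (hr : G.edist u y = r) (hb : 0 < r → ¬ inBall G u r y x) :
    G.edist x y = ((r + 1 : ℕ) : ℕ∞) := by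
  have h1 : G.edist x y ≤ ((r + 1 : ℕ) : ℕ∞) := by
    refine (SimpleGraph.edist_triangle (v := u)).trans ?_
    rw [hr, SimpleGraph.edist_eq_one_iff_adj.mpr hux.symm]
    push_cast
    rw [add_comm]
  by_contra hne
  have h2 : G.edist x y < ((r + 1 : ℕ) : ℕ∞) := lt_of_le_of_ne h1 hne
  have h3 : G.edist y x ≠ ⊤ := by
    rw [SimpleGraph.edist_comm]; exact ne_top_of_lt h2
  obtain ⟨q, hq⟩ := SimpleGraph.exists_walk_of_edist_ne_top h3
  rw [SimpleGraph.edist_comm, ← hq] at h2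
  have h2' : q.length < r + 1 := by exact_mod_cast h2
  classical
  have hu : u ∉ q.support := by
    intro hu
    have a1 := SimpleGraph.edist_le (q.takeUntil u hu)
    rw [SimpleGraph.edist_comm, hr] at a1
    have a1' : r ≤ (q.takeUntil u hu).length := by exact_mod_cast a1
    have a2 : (q.dropUntil u hu).length ≠ 0 := by
      intro h0
      exact hux.ne (SimpleGraph.Walk.eq_of_length_eq_zero h0)
    have a3 := congrArg SimpleGraph.Walk.length (q.take_spec hu)
    rw [SimpleGraph.Walk.length_append] at a3
    omega
  rcases Nat.eq_zero_or_pos r with h0 | hpos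
  · subst h0
    have : G.edist u y = 0 := by exact_mod_cast hr
    rw [SimpleGraph.edist_eq_zero_iff] at this
    subst this
    exact hu q.start_mem_support
  · exact hb hpos (inBall_of_walk G u q r (by omega) hu)

open Classical in
theorem embed_aux {V : Type*} (G : SimpleGraph V) [Fintype V] (O : V → V → Prop)
    (hO : IsOrientation G O) (m a : ℕ) (ha : 1 ≤ a) (D : ℝ)
    (H1 : ∀ u (w : Fin (m - 1) → V), ((univ.filter fun x => G.Adj u x ∧
      ∃ i, inBall G u (i.1 + 1) (w i) x).card : ℝ) < D)
    (H2 : ∀ A : Finset V, A.card = a → D * a ≤ edgesIn G A) :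
    ∀ j, j ≤ m → ∀ (W : Type) (_ : Fintype W), Fintype.card W = j + 1 → ∀ E : W → W → Prop,
      IsOrientedTree E → ∀ S : Finset V, j * (a - 1) < S.card →
      ∃ f : W → V, (∀ w, f w ∈ S) ∧ (∀ x y, E x y → O (f x) (f y)) ∧
        ∀ x y, G.edist (f x) (f y) = ((SimpleGraph.fromRel E).dist x y : ℕ∞) := by
  intro j
  induction j with
  | zero =>
    intro _ W _ hW E hE S hS
    obtain ⟨s, hs⟩ := Finset.card_pos.mp (by omega : 0 < S.card)
    have hsub : Subsingleton W := Fintype.card_le_one_iff_subsingleton.mp (by omega)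
    refine ⟨fun _ => s, fun _ => hs, ?_, ?_⟩
    · intro x y hxy
      rw [hsub.elim y x] at hxy
      exact absurd ⟨hxy, hxy⟩ (hE.1 x x)
    · intro x y
      rw [hsub.elim y x]
      simp
  | succ j ih =>
    intro hj W _ hW E hE S hS
    set T := SimpleGraph.fromRel E with hTdef
    have hT : T.IsTree := hE.2
    have : Nontrivial W := Fintype.one_lt_card_iff_nontrivial.mp (by omega)
    obtain ⟨v, hv⟩ := hT.exists_vert_degree_one_of_nontrivial
    have hconn' := hT.connected.induce_compl_singleton_of_degree_eq_one hv
    obtain ⟨u, hvu, hl⟩ := SimpleGraph.degree_eq_one_iff_existsUnique_adj.mp hv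
    have huv : u ≠ v := hvu.ne.symm
    let E' : ({v}ᶜ : Set W) → ({v}ᶜ : Set W) → Prop := fun x y => E x y
    have hTE' : SimpleGraph.fromRel E' = T.induce {v}ᶜ := by
      ext x y
      simp [E', hTdef, SimpleGraph.fromRel_adj, Subtype.ext_iff]
    have hE' : IsOrientedTree E' := by
      refine ⟨fun x y => hE.1 x y, ?_⟩
      rw [hTE']
      exact ⟨hconn', hT.isAcyclic.induce _⟩
    have hcard : Fintype.card ({v}ᶜ : Set W) = j + 1 := by
      rw [Fintype.card_compl_set]
      simp [hW]
    -- choose the direction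
    obtain ⟨Q, hQ, hQ2⟩ : ∃ Q : V → V → Prop, (∀ x y, G.Adj x y ↔ (Q x y ∨ Q y x)) ∧
        (∀ p q : V, Q p q → (E u v → O p q) ∧ (E v u → O q p)) := by
      have hadj : E v u ∨ E u v := by
        rw [hTdef, SimpleGraph.fromRel_adj] at hvu
        exact hvu.2
      rcases hadj with h | h
      · refine ⟨fun x y => O y x, fun x y => by rw [hO.2 x y, or_comm], ?_⟩
        intro p q hpq
        exact ⟨fun h' => absurd ⟨h, h'⟩ (hE.1 v u), fun _ => hpq⟩
      · refine ⟨O, hO.2, ?_⟩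
        intro p q hpq
        exact ⟨fun _ => hpq, fun h' => absurd ⟨h, h'⟩ (hE.1 u v)⟩
    have hlow := low_card G a ha D H2 Q (fun x y h => (hQ x y).1 h) S
    set L := S.filter (fun v => ((S.filter (fun x => Q v x)).card : ℝ) < D) with hL
    have hS' : j * (a - 1) < (S \ L).card := by
      have h1 := Finset.card_sdiff_add_card_eq_card (show L ⊆ S from Finset.filter_subset _ S)
      have h2 : (j + 1) * (a - 1) = j * (a - 1) + (a - 1) := by ring
      omega
    obtain ⟨f', hf1, hf2, hf3⟩ := ih (by omega) _ inferInstance hcard E' hE' (S \ L) hS'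
    rw [hTE'] at hf3
    have hf3' : ∀ x y, G.edist (f' x) (f' y) = (T.dist x.1 y.1 : ℕ∞) := by
      intro x y
      rw [hf3, induce_dist hT _ hconn']
    let u' : ({v}ᶜ : Set W) := ⟨u, huv⟩
    obtain ⟨e, he⟩ := rank_exists (j + 1) hcard (fun w => (T.induce {v}ᶜ).dist u' w)
      (fun w t ht => dist_gap hconn' u' w t ht)
    let tup : Fin (m - 1) → V := fun i =>
      if h : i.1 + 1 < j + 1 then f' (e ⟨i.1 + 1, h⟩) else f' u'
    have hbad := H1 (f' u') tup
    have hmem := hf1 u'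
    rw [Finset.mem_sdiff] at hmem
    have hout : D ≤ ((S.filter (fun x => Q (f' u') x)).card : ℝ) := by
      by_contra hcon
      exact hmem.2 (by rw [hL, Finset.mem_filter]; exact ⟨hmem.1, not_le.mp hcon⟩)
    obtain ⟨x, hx1, hx2⟩ := Finset.exists_mem_notMem_of_card_lt_card
      (by exact_mod_cast hbad.trans_le hout)
    rw [Finset.mem_filter] at hx1
    have hadjx : G.Adj (f' u') x := (hQ _ _).2 (Or.inl hx1.2)
    have hnb : ∀ w : ({v}ᶜ : Set W), 0 < T.dist u w.1 →
        ¬ inBall G (f' u') (T.dist u w.1) (f' w) x := by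
      intro w hpos hin
      apply hx2
      rw [Finset.mem_filter]
      refine ⟨Finset.mem_univ _, hadjx, ?_⟩
      obtain ⟨i, hi⟩ := e.surjective w
      have hle := he i
      simp only [hi] at hle
      rw [induce_dist hT _ hconn'] at hle
      change T.dist u w.1 ≤ i.1 at hle
      obtain ⟨k, hk⟩ : ∃ k, i.1 = k + 1 := ⟨i.1 - 1, by omega⟩
      have hi2 := i.2
      refine ⟨⟨k, by omega⟩, ?_⟩
      have htup : tup ⟨k, by omega⟩ = f' w := by
        simp only [tup]
        rw [dif_pos (by omega), ← hi]
        congr 2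
        exact Fin.ext hk.symm
      rw [htup]
      -- monotonicity
      have mono : ∀ r s, r ≤ s → ∀ y, inBall G (f' u') r y x → inBall G (f' u') s y x := by
        intro r
        induction r with
        | zero =>
          intro s _ y hy
          cases s with
          | zero => exact hy
          | succ s => exact ⟨hy.1, Or.inl hy.2⟩
        | succ r ihr =>
          intro s hs y hy
          cases s with
          | zero => omega
          | succ s =>
            refine ⟨hy.1, ?_⟩
            rcases hy.2 with h | ⟨z, hz, h⟩
            · exact Or.inl h
            · exact Or.inr ⟨z, hz, ihr s (by omega) z h⟩
      exact mono _ _ (show T.dist u w.1 ≤ k + 1 by omega) _ hin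
    have hnew : ∀ w : ({v}ᶜ : Set W), G.edist x (f' w) = (T.dist v w.1 : ℕ∞) := by
      intro w
      rw [leaf_dist hT.connected hvu hl w.2]
      exact new_dist G (T.dist u w.1) hadjx (hf3' u' w) (hnb w)
    let f : W → V := fun w => if h : w = v then x else f' ⟨w, h⟩
    have fv : f v = x := by simp [f]
    have fne : ∀ w (h : w ≠ v), f w = f' ⟨w, h⟩ := by
      intro w h
      simp [f, h]
    refine ⟨f, ?_, ?_, ?_⟩
    · intro w
      by_cases h : w = v
      · rw [h, fv]; exact hx1.1
      · rw [fne w h]; exact (Finset.mem_sdiff.mp (hf1 _)).1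
    · intro p q hpq
      have hEadj : ∀ p q, E p q → T.Adj p q := by
        intro p q hpq
        rw [hTdef, SimpleGraph.fromRel_adj]
        refine ⟨?_, Or.inl hpq⟩
        rintro rfl
        exact hE.1 p p ⟨hpq, hpq⟩
      by_cases hp : p = v
      · subst hp
        have hq : q = u := hl q (hEadj _ _ hpq)
        subst hq
        rw [fv, fne q huv]
        exact (hQ2 _ _ hx1.2).2 hpq
      · by_cases hq : q = v
        · subst hq
          have hp' : p = u := hl p (hEadj _ _ hpq).symm
          subst hp'
          rw [fv, fne p huv]
          exact (hQ2 _ _ hx1.2).1 hpq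
        · rw [fne p hp, fne q hq]
          exact hf2 _ _ hpq
    · intro p q
      by_cases hp : p = v
      · subst hp
        by_cases hq : q = p
        · subst hq; simp
        · rw [fv, fne q hq]; exact hnew ⟨q, hq⟩
      · by_cases hq : q = v
        · subst hq
          rw [fv, fne p hp, SimpleGraph.edist_comm, SimpleGraph.dist_comm]
          exact hnew ⟨p, hp⟩
        · rw [fne p hp, fne q hq]; exact hf3' _ _

open Classical in
theorem det_main {V : Type*} (G : SimpleGraph V) [Fintype V] (m a : ℕ) (ha : 1 ≤ a) (D : ℝ)
    (H1 : ∀ u (w : Fin (m - 1) → V), ((univ.filter fun x => G.Adj u x ∧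
      ∃ i, inBall G u (i.1 + 1) (w i) x).card : ℝ) < D)
    (H2 : ∀ A : Finset V, A.card = a → D * a ≤ edgesIn G A)
    (H3 : m * (a - 1) < Fintype.card V) : IsoRamseyArrowTrees G (m + 1) := by
  intro W _ hW E hE O hO
  obtain ⟨f, -, h2, h3⟩ := embed_aux G O hO m a ha D H1 H2 m le_rfl W inferInstance hW E hE univ
    (by rw [Finset.card_univ]; exact H3)
  have hed : ∀ x y, (SimpleGraph.fromRel E).edist x y = G.edist (f x) (f y) := by
    intro x y
    rw [h3, (hE.2.connected x y).coe_dist_eq_edist]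
  refine ⟨f, ?_, ?_, hed⟩
  · intro x y hxy
    have := hed x y
    rw [hxy, SimpleGraph.edist_self, SimpleGraph.edist_eq_zero_iff] at this
    exact this
  · intro x y
    refine ⟨h2 x y, fun h => ?_⟩
    have hadj : G.Adj (f x) (f y) := (hO.2 _ _).2 (Or.inl h)
    have := hed x y
    rw [SimpleGraph.edist_eq_one_iff_adj.mpr hadj, SimpleGraph.edist_eq_one_iff_adj,
      SimpleGraph.fromRel_adj] at this
    rcases this.2 with h' | h'
    · exact h'
    · exact absurd ⟨h, h2 _ _ h'⟩ (hO.1 _ _)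

theorem small_case {V : Type*} [Fintype V] (G : SimpleGraph V) (hG : ∀ x y, x ≠ y → G.Adj x y)
    (n N : ℕ) (hV : Fintype.card V = N) (hn : n = 1 ∧ 1 ≤ N ∨ n = 2 ∧ 2 ≤ N) :
    IsoRamseyArrowTrees G n := by
  classical
  obtain ⟨m, rfl⟩ : ∃ m, n = m + 1 := ⟨n - 1, by omega⟩
  have hm : m - 1 = 0 := by omega
  refine det_main _ m 2 (by norm_num) (1 / 2) ?_ ?_ ?_
  · intro u w
    rw [Finset.filter_false_of_mem]
    · norm_num
    · rintro x _ ⟨_, i, _⟩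
      exact absurd i.2 (by omega)
  · intro A hA
    obtain ⟨x, y, hxy, rfl⟩ := Finset.card_eq_two.mp hA
    have : 1 ≤ edgesIn G {x, y} := by
      unfold edgesIn
      rw [Nat.one_le_iff_ne_zero, Finset.card_ne_zero]
      refine ⟨s(x, y), ?_⟩
      rw [Finset.mem_filter, Finset.mem_image]
      refine ⟨⟨(x, y), ?_, rfl⟩, ?_⟩
      · simp [hxy]
      · exact hG x y hxy
    have : (1 : ℝ) ≤ edgesIn G {x, y} := by exact_mod_cast this
    norm_num
    linarith
  · rw [hV]; omega

/-- weight of a configuration -/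
noncomputable def wt {ι : Type*} [Fintype ι] (p : ℝ) (ω : ι → Bool) : ℝ :=
  ∏ e, (if ω e then p else 1 - p)

/-- expectation -/
noncomputable def Ex {ι : Type*} [Fintype ι] [DecidableEq ι] (p : ℝ) (f : (ι → Bool) → ℝ) : ℝ :=
  ∑ ω, wt p ω * f ω

section prob
variable {ι : Type*} [Fintype ι] [DecidableEq ι] {p : ℝ}

theorem wt_nonneg (hp0 : 0 ≤ p) (hp1 : p ≤ 1) (ω : ι → Bool) : 0 ≤ wt p ω := by
  apply Finset.prod_nonneg
  intro e _
  split_ifs <;> linarith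

theorem Ex_one : Ex p (fun _ : ι → Bool => 1) = 1 := by
  unfold Ex wt
  simp only [mul_one]
  have := (Finset.prod_univ_sum (fun _ : ι => (Finset.univ : Finset Bool))
    (fun _ b => if b = true then p else 1 - p)).symm
  rw [Fintype.piFinset_univ] at this
  rw [this]
  simp

theorem Ex_mono (hp0 : 0 ≤ p) (hp1 : p ≤ 1) {f g : (ι → Bool) → ℝ} (h : ∀ ω, f ω ≤ g ω) :
    Ex p f ≤ Ex p g :=
  Finset.sum_le_sum fun ω _ => mul_le_mul_of_nonneg_left (h ω) (wt_nonneg hp0 hp1 ω)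

theorem Ex_sum {κ : Type*} (s : Finset κ) (f : κ → (ι → Bool) → ℝ) :
    Ex p (fun ω => ∑ k ∈ s, f k ω) = ∑ k ∈ s, Ex p (f k) := by
  unfold Ex
  rw [Finset.sum_comm]
  simp only [Finset.mul_sum]

theorem Ex_add (f g : (ι → Bool) → ℝ) :
    Ex p (fun ω => f ω + g ω) = Ex p f + Ex p g := by
  unfold Ex
  rw [← Finset.sum_add_distrib]
  simp only [mul_add]

theorem Ex_const_mul (a : ℝ) (f : (ι → Bool) → ℝ) :
    Ex p (fun ω => a * f ω) = a * Ex p f := by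
  unfold Ex
  rw [Finset.mul_sum]
  exact Finset.sum_congr rfl fun ω _ => by ring

theorem Ex_coord (e : ι) (g : (ι → Bool) → ℝ)
    (hg : ∀ ω b, g (Function.update ω e b) = g ω) (t : ℝ) :
    Ex p (fun ω => g ω * (if ω e then t else 1)) = (1 - p + p * t) * Ex p g := by
  have key : ∀ φ : Bool → ℝ, Ex p (fun ω => g ω * φ (ω e)) =
      (p * φ true + (1 - p) * φ false) *
        ∑ η : ({j // j ≠ e} → Bool), (∏ j, (if η j then p else 1 - p)) *
          g ((Equiv.funSplitAt e Bool).symm (true, η)) := by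
    intro φ
    unfold Ex
    rw [← (Equiv.funSplitAt e Bool).symm.sum_comp, Fintype.sum_prod_type, Fintype.sum_bool,
      add_mul, Finset.mul_sum, Finset.mul_sum]
    have hw : ∀ (b : Bool) (η : {j // j ≠ e} → Bool),
        wt p ((Equiv.funSplitAt e Bool).symm (b, η)) =
          (if b then p else 1 - p) * ∏ j, (if η j then p else 1 - p) := by
      intro b η
      unfold wt
      rw [Fintype.prod_eq_mul_prod_subtype_ne _ e]
      congr 1
      · simp [Equiv.funSplitAt, Equiv.piSplitAt]
      · apply Finset.prod_congr rfl
        intro j _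
        have := j.2
        simp [Equiv.funSplitAt, Equiv.piSplitAt, this]
    have he : ∀ (b : Bool) (η : {j // j ≠ e} → Bool),
        ((Equiv.funSplitAt e Bool).symm (b, η)) e = b := by
      intro b η
      simp [Equiv.funSplitAt, Equiv.piSplitAt]
    have hgt : ∀ (η : {j // j ≠ e} → Bool), g ((Equiv.funSplitAt e Bool).symm (false, η)) =
        g ((Equiv.funSplitAt e Bool).symm (true, η)) := by
      intro η
      rw [← hg ((Equiv.funSplitAt e Bool).symm (true, η)) false]
      congr 1
      funext j
      by_cases h : j = e
      · subst h; simp [Equiv.funSplitAt, Equiv.piSplitAt]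
      · simp [Equiv.funSplitAt, Equiv.piSplitAt, h]
    congr 1
    · apply Finset.sum_congr rfl
      intro η _
      rw [hw]; beta_reduce; rw [he]
      simp only [if_true]
      ring
    · apply Finset.sum_congr rfl
      intro η _
      rw [hw]; beta_reduce; rw [he, hgt]
      simp only [Bool.false_eq_true, if_false]
      ring
  have h1 := key (fun b => if b then t else 1)
  have h2 := key (fun _ => 1)
  simp only [mul_one] at h2
  rw [h1, show Ex p g = Ex p (fun ω => g ω) from rfl, h2]
  simp only [if_true, Bool.false_eq_true, if_false]
  ring

theorem Ex_prod (t : ℝ) (F : Finset ι) (g : (ι → Bool) → ℝ)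
    (hg : ∀ e ∈ F, ∀ ω b, g (Function.update ω e b) = g ω) :
    Ex p (fun ω => g ω * ∏ e ∈ F, (if ω e then t else 1)) = (1 - p + p * t) ^ F.card * Ex p g := by
  induction F using Finset.induction_on with
  | empty => simp
  | insert e F he ih =>
    rw [Finset.card_insert_of_notMem he, pow_succ, mul_comm (_ ^ _) _, mul_assoc, ← ih (fun e' h' =>
      hg e' (Finset.mem_insert_of_mem h')), ← Ex_coord e]
    · congr 1
      funext ω
      rw [Finset.prod_insert he]
      ring
    · intro ω b
      rw [hg e (Finset.mem_insert_self _ _)]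
      congr 1
      apply Finset.prod_congr rfl
      intro e' he'
      have : e' ≠ e := fun h => he (h ▸ he')
      rw [Function.update_of_ne this]

open Classical in
theorem tail_bound (hp0 : 0 ≤ p) (hp1 : p ≤ 1) (t : ℝ) (ht : 0 < t) (K s : ℝ) (F : Finset ι)
    (hs : (t - 1) * F.card ≤ (t - 1) * s)
    (g : (ι → Bool) → ℝ) (hg0 : ∀ ω, 0 ≤ g ω)
    (hg : ∀ e ∈ F, ∀ ω b, g (Function.update ω e b) = g ω)
    (A : (ι → Bool) → Prop)
    (hA : ∀ ω, A ω → K * Real.log t ≤ (F.filter (fun e => ω e = true)).card * Real.log t) :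
    Ex p (fun ω => g ω * (if A ω then 1 else 0)) ≤
      Real.exp (- K * Real.log t + p * (t - 1) * s) * Ex p g := by
  have hEg : 0 ≤ Ex p g := Finset.sum_nonneg fun ω _ => mul_nonneg (wt_nonneg hp0 hp1 ω) (hg0 ω)
  have h1 : Ex p (fun ω => g ω * (if A ω then 1 else 0)) ≤
      Ex p (fun ω => Real.exp (- K * Real.log t) *
        (g ω * ∏ e ∈ F, (if ω e then t else 1))) := by
    apply Ex_mono hp0 hp1
    intro ω
    have hpr : ∏ e ∈ F, (if ω e = true then t else 1) =
        Real.exp ((F.filter (fun e => ω e = true)).card * Real.log t) := by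
      rw [Finset.prod_ite, Finset.prod_const, Finset.prod_const_one, mul_one, mul_comm,
        Real.exp_mul, Real.exp_log ht, Real.rpow_natCast]
    rw [hpr, show Real.exp (-K * Real.log t) *
      (g ω * Real.exp ((F.filter (fun e => ω e = true)).card * Real.log t)) =
      g ω * (Real.exp (-K * Real.log t) *
        Real.exp ((F.filter (fun e => ω e = true)).card * Real.log t)) from by ring,
      ← Real.exp_add]
    apply mul_le_mul_of_nonneg_left _ (hg0 ω)
    split_ifs with h
    · apply Real.one_le_exp
      have := hA ω h
      linarith
    · positivity
  refine h1.trans ?_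
  rw [Ex_const_mul, Ex_prod t F g hg, ← mul_assoc, Real.exp_add]
  apply mul_le_mul_of_nonneg_right _ hEg
  apply mul_le_mul_of_nonneg_left _ (Real.exp_pos _).le
  have h2 : 1 - p + p * t ≤ Real.exp (p * (t - 1)) := by
    have := Real.add_one_le_exp (p * (t - 1))
    linarith
  have h3 : 0 ≤ 1 - p + p * t := by nlinarith
  calc (1 - p + p * t) ^ F.card ≤ Real.exp (p * (t - 1)) ^ F.card := pow_le_pow_left₀ h3 h2 _
    _ = Real.exp (F.card * (p * (t - 1))) := by rw [← Real.exp_nat_mul]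
    _ ≤ _ := by
      apply Real.exp_le_exp.mpr
      nlinarith

end prob

/-- random graph -/
def Gr {V : Type*} (ω : Sym2 V → Bool) : SimpleGraph V where
  Adj x y := x ≠ y ∧ ω s(x, y) = true
  symm := ⟨fun x y h => ⟨h.1.symm, by rw [Sym2.eq_swap]; exact h.2⟩⟩
  loopless := ⟨fun x h => h.1 rfl⟩

theorem inBall_ne {V : Type*} (G : SimpleGraph V) (u : V) (r : ℕ) (w x : V)
    (h : inBall G u r w x) : w ≠ u := by
  cases r with
  | zero => exact h.1
  | succ r => exact h.1

theorem inBall_congr {V : Type*} (G G' : SimpleGraph V) (u : V)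
    (h : ∀ x y, x ≠ u → y ≠ u → (G.Adj x y ↔ G'.Adj x y)) (r : ℕ) :
    ∀ w x, inBall G u r w x ↔ inBall G' u r w x := by
  induction r with
  | zero => intro w x; exact Iff.rfl
  | succ r ih =>
    intro w x
    simp only [inBall]
    refine and_congr_right fun hw => or_congr_right ?_
    constructor
    · rintro ⟨y, h1, h2⟩
      exact ⟨y, (h w y hw (inBall_ne _ _ _ _ _ h2)).1 h1, (ih y x).1 h2⟩
    · rintro ⟨y, h1, h2⟩
      exact ⟨y, (h w y hw (inBall_ne _ _ _ _ _ h2)).2 h1, (ih y x).2 h2⟩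

open Classical in
theorem ball_card {V : Type*} [Fintype V] (G : SimpleGraph V) (Δ : ℝ) (hΔ : 0 ≤ Δ)
    (hdeg : ∀ v, ((univ.filter fun x => G.Adj v x).card : ℝ) ≤ Δ) (u : V) (r : ℕ) :
    ∀ w, ((univ.filter fun x => inBall G u r w x).card : ℝ) ≤ ∑ j ∈ range (r + 1), Δ ^ j := by
  induction r with
  | zero =>
    intro w
    have : (univ.filter fun x => inBall G u 0 w x) ⊆ {w} := by
      intro x hx
      rw [mem_filter] at hx
      rw [mem_singleton]
      exact hx.2.2
    have := Finset.card_le_card this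
    simp at this ⊢
    exact_mod_cast this
  | succ r ih =>
    intro w
    have hsub : (univ.filter fun x => inBall G u (r + 1) w x) ⊆
        {w} ∪ (univ.filter fun x => G.Adj w x).biUnion
          (fun y => univ.filter fun x => inBall G u r y x) := by
      intro x hx
      rw [mem_filter] at hx
      rw [mem_union, mem_singleton, mem_biUnion]
      rcases hx.2.2 with h | ⟨y, h1, h2⟩
      · exact Or.inl h
      · exact Or.inr ⟨y, by simp [h1], by simp [h2]⟩
    have h1 := (Finset.card_le_card hsub).trans (Finset.card_union_le _ _)
    have h2 : (((univ.filter fun x => G.Adj w x).biUnion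
          (fun y => univ.filter fun x => inBall G u r y x)).card : ℝ) ≤
          Δ * ∑ j ∈ range (r + 1), Δ ^ j := by
      calc (((univ.filter fun x => G.Adj w x).biUnion
          (fun y => univ.filter fun x => inBall G u r y x)).card : ℝ) ≤
          ∑ y ∈ (univ.filter fun x => G.Adj w x),
            ((univ.filter fun x => inBall G u r y x).card : ℝ) := by
            exact_mod_cast Finset.card_biUnion_le
        _ ≤ ∑ y ∈ (univ.filter fun x => G.Adj w x), ∑ j ∈ range (r + 1), Δ ^ j :=
            Finset.sum_le_sum fun y _ => ih y
        _ = (univ.filter fun x => G.Adj w x).card * ∑ j ∈ range (r + 1), Δ ^ j := by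
            rw [Finset.sum_const, nsmul_eq_mul]
        _ ≤ _ := by
            apply mul_le_mul_of_nonneg_right (hdeg w)
            exact Finset.sum_nonneg fun j _ => pow_nonneg hΔ j
    have h3 : ((univ.filter fun x => inBall G u (r + 1) w x).card : ℝ) ≤ 1 +
      (((univ.filter fun x => G.Adj w x).biUnion
          (fun y => univ.filter fun x => inBall G u r y x)).card : ℝ) := by
      rw [Finset.card_singleton] at h1
      exact_mod_cast h1
    rw [Finset.sum_range_succ', pow_zero]
    simp only [pow_succ']
    rw [← Finset.mul_sum]
    linarith

theorem geom_bound (c q : ℝ) (hc : 0 < c) (hq : 1 + c ≤ c * q) (r : ℕ) :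
    ∑ j ∈ range (r + 1), q ^ j ≤ (1 + c) * q ^ r := by
  have hq0 : 0 < q := by
    by_contra h
    nlinarith
  induction r with
  | zero => simp; linarith
  | succ r ih =>
    rw [Finset.sum_range_succ]
    have : 0 < q ^ r := pow_pos hq0 r
    rw [pow_succ]
    nlinarith

open Classical in
theorem union_card {V : Type*} [Fintype V] (G : SimpleGraph V) (c Δ : ℝ) (hc : 0 < c)
    (hq : 1 + c ≤ c * Δ)
    (hdeg : ∀ v, ((univ.filter fun x => G.Adj v x).card : ℝ) ≤ Δ) (u : V) (m : ℕ)
    (w : Fin (m - 1) → V) :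
    ((univ.filter fun x => ∃ i, inBall G u (i.1 + 1) (w i) x).card : ℝ) ≤
      (1 + c) ^ 2 * Δ ^ (m - 1) := by
  have hΔ : 0 < Δ := by
    by_contra h
    nlinarith
  have hsub : (univ.filter fun x => ∃ i, inBall G u (i.1 + 1) (w i) x) ⊆
      univ.biUnion (fun i : Fin (m - 1) => univ.filter fun x => inBall G u (i.1 + 1) (w i) x) := by
    intro x hx
    rw [mem_filter] at hx
    rw [mem_biUnion]
    obtain ⟨i, hi⟩ := hx.2
    exact ⟨i, mem_univ _, by simp [hi]⟩
  calc ((univ.filter fun x => ∃ i, inBall G u (i.1 + 1) (w i) x).card : ℝ) ≤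
      ∑ i : Fin (m - 1), ((univ.filter fun x => inBall G u (i.1 + 1) (w i) x).card : ℝ) := by
        exact_mod_cast (Finset.card_le_card hsub).trans Finset.card_biUnion_le
    _ ≤ ∑ i : Fin (m - 1), (1 + c) * Δ ^ (i.1 + 1) := Finset.sum_le_sum fun i _ =>
        (ball_card G Δ hΔ.le hdeg u _ _).trans (geom_bound c Δ hc hq _)
    _ = ∑ i ∈ range (m - 1), (1 + c) * Δ ^ (i + 1) :=
        Fin.sum_univ_eq_sum_range (fun i => (1 + c) * Δ ^ (i + 1)) (m - 1)
    _ ≤ (1 + c) * ∑ j ∈ range (m - 1 + 1), Δ ^ j := by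
        rw [← Finset.mul_sum, Finset.sum_range_succ' _ (m - 1)]
        have : (0 : ℝ) ≤ Δ ^ 0 := by simp
        nlinarith
    _ ≤ (1 + c) * ((1 + c) * Δ ^ (m - 1)) :=
        mul_le_mul_of_nonneg_left (geom_bound c Δ hc hq _) (by linarith)
    _ = _ := by ring

theorem log_up (c : ℝ) (hc0 : 0 < c) (hc1 : c < 1) :
    c ^ 2 / 3 ≤ (1 + c) * Real.log (1 + c) - c := by
  have h := Real.le_log_one_add_of_nonneg hc0.le
  have h1 : (1 + c) * (2 * c / (c + 2)) - c = c ^ 2 / (c + 2) := by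
    field_simp; ring
  have h2 : c ^ 2 / 3 ≤ c ^ 2 / (c + 2) := by
    apply div_le_div_of_nonneg_left (by positivity) (by linarith) (by linarith)
  nlinarith

theorem log_down (c : ℝ) (hc0 : 0 < c) (hc1 : c < 1) :
    c ^ 2 / 2 ≤ (1 - c) * Real.log (1 - c) + c := by
  have h0 : 0 < 1 - c := by linarith
  have h1 : 0 ≤ - Real.log (1 - c) := by
    have := Real.log_nonpos h0.le (by linarith)
    linarith
  have h2 := Real.self_le_sinh_iff.mpr h1
  rw [Real.sinh_neg, Real.sinh_log h0] at h2
  have h3 : (1 - c) * (- Real.log (1 - c)) ≤ (1 - c) * -(((1 - c) - (1 - c)⁻¹) / 2) :=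
    mul_le_mul_of_nonneg_left h2 h0.le
  have h4 : (1 - c) * (1 - c)⁻¹ = 1 := mul_inv_cancel₀ h0.ne'
  nlinarith

open Classical in
theorem prob_deg {V : Type*} [Fintype V] [DecidableEq V] (c p : ℝ) (hc0 : 0 < c) (hc1 : c < 1)
    (hp0 : 0 < p) (hp1 : p ≤ 1) (N : ℕ) (hV : Fintype.card V = N) (v : V) :
    Ex p (fun ω : Sym2 V → Bool => if (1 + c) * (p * N) <
      ((univ.filter fun x => (Gr ω).Adj v x).card : ℝ) then 1 else 0) ≤
      Real.exp (-(c ^ 2 * p * N / 3)) := by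
  have hlog : 0 < Real.log (1 + c) := Real.log_pos (by linarith)
  have h := tail_bound (ι := Sym2 V) hp0.le hp1 (1 + c) (by linarith) ((1 + c) * (p * N)) N
    (univ.image (fun x : V => s(v, x))) (by
      have : ((univ.image (fun x : V => s(v, x))).card : ℝ) ≤ N := by
        rw [← hV]; exact_mod_cast Finset.card_image_le
      nlinarith) (fun _ => 1) (fun _ => zero_le_one) (fun _ _ _ _ => rfl)
    (fun ω => (1 + c) * (p * N) < ((univ.filter fun x => (Gr ω).Adj v x).card : ℝ)) (by
      intro ω hω
      apply mul_le_mul_of_nonneg_right _ hlog.le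
      refine hω.le.trans ?_
      have : ((univ.filter fun x => (Gr ω).Adj v x)).card ≤
        ((univ.image (fun x : V => s(v, x))).filter (fun e => ω e = true)).card := by
        apply Finset.card_le_card_of_injOn (fun x => s(v, x))
        · intro x hx
          rw [mem_coe, mem_filter] at hx
          rw [mem_coe, mem_filter]
          exact ⟨mem_image_of_mem _ (mem_univ _), hx.2.2⟩
        · intro x _ y _ hxy
          exact Sym2.congr_right.mp hxy
      exact_mod_cast this)
  rw [Ex_one, mul_one] at h
  simp only [one_mul] at h
  refine h.trans (Real.exp_le_exp.mpr ?_)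
  have h1 := log_up c hc0 hc1
  have h2 : 0 ≤ p * N := by positivity
  nlinarith

open Classical in
theorem prob_ball {V : Type*} [Fintype V] [DecidableEq V] (p C M : ℝ)
    (hp0 : 0 < p) (hp1 : p ≤ 1) (hC : 1 < C) (m : ℕ)
    (u : V) (w : Fin (m - 1) → V) :
    Ex p (fun ω : Sym2 V → Bool => if
      ((univ.filter fun x => ∃ i, inBall (Gr ω) u (i.1 + 1) (w i) x).card : ℝ) ≤ M ∧
      C * p * M ≤ ((univ.filter fun x => (Gr ω).Adj u x ∧
        ∃ i, inBall (Gr ω) u (i.1 + 1) (w i) x).card : ℝ) then 1 else 0) ≤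
      Real.exp (-((1 - C + C * Real.log C) * p * M)) := by
  have hlog : 0 < Real.log C := Real.log_pos hC
  let B : (Sym2 V → Bool) → Finset V := fun ω =>
    univ.filter fun x => ∃ i, inBall (Gr ω) u (i.1 + 1) (w i) x
  let g : Finset V → (Sym2 V → Bool) → ℝ := fun B0 ω => if B ω = B0 then 1 else 0
  have hg0 : ∀ B0 ω, 0 ≤ g B0 ω := by
    intro B0 ω
    simp only [g]
    split_ifs <;> norm_num
  have hgs : ∀ ω, ∑ B0, g B0 ω = 1 := by
    intro ω
    simp [g]
  have hgi : ∀ B0 : Finset V, ∀ e ∈ B0.image (fun x : V => s(u, x)), ∀ ω b,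
      g B0 (Function.update ω e b) = g B0 ω := by
    intro B0 e he ω b
    obtain ⟨x, _, rfl⟩ := Finset.mem_image.mp he
    have : B (Function.update ω s(u, x) b) = B ω := by
      simp only [B]
      apply Finset.filter_congr
      intro y _
      apply exists_congr
      intro i
      apply inBall_congr
      intro z z' hz hz'
      have hne : s(z, z') ≠ s(u, x) := by
        intro h
        rw [Sym2.eq_iff] at h
        rcases h with h | h
        · exact hz h.1
        · exact hz' h.2
      simp only [Gr, Function.update_of_ne hne]
    simp only [g, this]
  let A : Finset V → (Sym2 V → Bool) → Prop := fun B0 ω =>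
    C * p * M ≤ ((B0.image (fun x : V => s(u, x))).filter (fun e => ω e = true)).card
  have hT : ∀ B0 ∈ univ.filter (fun B0 : Finset V => (B0.card : ℝ) ≤ M),
      Ex p (fun ω => g B0 ω * (if A B0 ω then 1 else 0)) ≤
      Real.exp (- (C * p * M) * Real.log C + p * (C - 1) * M) * Ex p (g B0) := by
    intro B0 hB0
    rw [mem_filter] at hB0
    apply tail_bound hp0.le hp1 C (by linarith) (C * p * M) M (B0.image (fun x : V => s(u, x)))
      _ (g B0) (hg0 B0) (hgi B0)
    · intro ω hω
      exact mul_le_mul_of_nonneg_right hω hlog.le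
    · have : ((B0.image (fun x : V => s(u, x))).card : ℝ) ≤ M := by
        refine le_trans ?_ hB0.2
        exact_mod_cast Finset.card_image_le
      nlinarith
  calc _ ≤ Ex p (fun ω => ∑ B0 ∈ univ.filter (fun B0 : Finset V => (B0.card : ℝ) ≤ M),
        g B0 ω * (if A B0 ω then 1 else 0)) := by
        apply Ex_mono hp0.le hp1
        intro ω
        have hnn : ∀ B0 ∈ univ.filter (fun B0 : Finset V => (B0.card : ℝ) ≤ M),
            0 ≤ g B0 ω * (if A B0 ω then (1 : ℝ) else 0) := by
          intro B0 _
          apply mul_nonneg (hg0 B0 ω)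
          split_ifs <;> norm_num
        split_ifs with h
        · have hmem : B ω ∈ univ.filter (fun B0 : Finset V => (B0.card : ℝ) ≤ M) := by
            rw [mem_filter]
            exact ⟨mem_univ _, h.1⟩
          refine le_trans ?_ (Finset.single_le_sum hnn hmem)
          have hA : A (B ω) ω := by
            simp only [A]
            refine h.2.trans ?_
            have : (univ.filter fun x => (Gr ω).Adj u x ∧
                ∃ i, inBall (Gr ω) u (i.1 + 1) (w i) x).card ≤
                (((B ω).image (fun x : V => s(u, x))).filter (fun e => ω e = true)).card := by
              apply Finset.card_le_card_of_injOn (fun x => s(u, x))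
              · intro x hx
                rw [mem_coe, mem_filter] at hx
                rw [mem_coe, mem_filter]
                refine ⟨mem_image_of_mem _ ?_, hx.2.1.2⟩
                simp only [B]
                rw [mem_filter]
                exact ⟨mem_univ _, hx.2.2⟩
              · intro x _ y _ hxy
                exact Sym2.congr_right.mp hxy
            exact_mod_cast this
          rw [if_pos hA]
          simp [g]
        · exact Finset.sum_nonneg hnn
    _ = ∑ B0 ∈ univ.filter (fun B0 : Finset V => (B0.card : ℝ) ≤ M),
        Ex p (fun ω => g B0 ω * (if A B0 ω then 1 else 0)) := Ex_sum _ _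
    _ ≤ ∑ B0 ∈ univ.filter (fun B0 : Finset V => (B0.card : ℝ) ≤ M),
        Real.exp (- (C * p * M) * Real.log C + p * (C - 1) * M) * Ex p (g B0) :=
        Finset.sum_le_sum hT
    _ ≤ ∑ B0 : Finset V,
        Real.exp (- (C * p * M) * Real.log C + p * (C - 1) * M) * Ex p (g B0) := by
        apply Finset.sum_le_sum_of_subset_of_nonneg (Finset.filter_subset _ _)
        intro B0 _ _
        apply mul_nonneg (Real.exp_pos _).le
        exact Finset.sum_nonneg fun ω _ => mul_nonneg (wt_nonneg hp0.le hp1 ω) (hg0 B0 ω)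
    _ = Real.exp (- (C * p * M) * Real.log C + p * (C - 1) * M) := by
        rw [← Finset.mul_sum, ← Ex_sum]
        simp only [hgs]
        rw [Ex_one, mul_one]
    _ = _ := by
        congr 1
        ring

open Classical in
theorem prob_edges {V : Type*} [Fintype V] [DecidableEq V] (c p D : ℝ) (hc0 : 0 < c) (hc1 : c < 1)
    (hp0 : 0 < p) (hp1 : p ≤ 1) (a : ℕ) (hD : D ≤ (1 - c) * p * ((a : ℝ) - 1) / 2)
    (S : Finset V) (hS : S.card = a) :
    Ex p (fun ω : Sym2 V → Bool => if (edgesIn (Gr ω) S : ℝ) < D * a then 1 else 0) ≤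
      Real.exp (-(c ^ 2 * p * a * (a - 1) / 4)) := by
  have hlog : Real.log (1 - c) < 0 := Real.log_neg (by linarith) (by linarith)
  have hcard : ((S.offDiag.image (fun z : V × V => s(z.1, z.2))).card : ℝ) = a * (a - 1) / 2 := by
    have := Sym2.card_image_offDiag S
    rw [hS] at this
    rw [← Nat.cast_choose_two]
    exact_mod_cast this
  have h := tail_bound (ι := Sym2 V) hp0.le hp1 (1 - c) (by linarith) (D * a) (a * (a - 1) / 2)
    (S.offDiag.image (fun z : V × V => s(z.1, z.2))) (by rw [hcard])
    (fun _ => 1) (fun _ => zero_le_one) (fun _ _ _ _ => rfl)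
    (fun ω => (edgesIn (Gr ω) S : ℝ) < D * a) (by
      intro ω hω
      apply mul_le_mul_of_nonpos_right _ hlog.le
      refine le_trans ?_ hω.le
      have : ((S.offDiag.image (fun z : V × V => s(z.1, z.2))).filter
          (fun e => ω e = true)).card ≤ edgesIn (Gr ω) S := by
        unfold edgesIn
        apply Finset.card_le_card
        intro e he
        simp only [mem_filter, mem_image, mem_offDiag, Prod.exists] at he ⊢
        refine ⟨he.1, ?_⟩
        obtain ⟨⟨x, y, ⟨_, _, hxy⟩, rfl⟩, hω⟩ := he
        exact ⟨hxy, hω⟩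
      exact_mod_cast this)
  rw [Ex_one, mul_one] at h
  simp only [one_mul] at h
  refine h.trans (Real.exp_le_exp.mpr ?_)
  have h1 := log_down c hc0 hc1
  have ha : (0 : ℝ) ≤ a := Nat.cast_nonneg a
  have h0 : (0 : ℝ) ≤ a * (a - 1) := by
    rcases Nat.eq_zero_or_pos a with h | h
    · simp [h]
    · have : (1 : ℝ) ≤ a := by exact_mod_cast h
      nlinarith
  have h2 : D * a ≤ (1 - c) * p * ((a : ℝ) - 1) / 2 * a := mul_le_mul_of_nonneg_right hD ha
  have h3 : D * a * (- Real.log (1 - c)) ≤ ((1 - c) * p * ((a : ℝ) - 1) / 2 * a) *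
    (- Real.log (1 - c)) := mul_le_mul_of_nonneg_right h2 (by linarith)
  have h4 : 0 ≤ p * (a * ((a : ℝ) - 1)) := by positivity
  nlinarith

open Classical in
theorem prob_main {V : Type*} [Fintype V] [DecidableEq V] (c p C M : ℝ) (hc0 : 0 < c) (hc1 : c < 1)
    (hp0 : 0 < p) (hp1 : p ≤ 1) (hC : 1 < C) (N : ℕ) (hV : Fintype.card V = N) (m a : ℕ)
    (hm : 1 ≤ m)
    (hM : M = (1 + c) ^ 2 * ((1 + c) * (p * N)) ^ (m - 1))
    (hq : 1 + c ≤ c * ((1 + c) * (p * N)))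
    (ha : C * p * M ≤ (1 - c) * p * ((a : ℝ) - 1) / 2)
    (h1 : N * Real.exp (-(c ^ 2 * p * N / 3)) < 1 / 3)
    (h2 : (N : ℝ) ^ m * Real.exp (-((1 - C + C * Real.log C) * p * M)) < 1 / 3)
    (h3 : (N.choose a : ℝ) * Real.exp (-(c ^ 2 * p * a * (a - 1) / 4)) < 1 / 3) :
    ∃ G : SimpleGraph V, (∀ u (w : Fin (m - 1) → V), ((univ.filter fun x => G.Adj u x ∧
      ∃ i, inBall G u (i.1 + 1) (w i) x).card : ℝ) < C * p * M) ∧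
      (∀ A : Finset V, A.card = a → C * p * M * a ≤ edgesIn G A) := by
  let f1 : V → (Sym2 V → Bool) → ℝ := fun v ω => if (1 + c) * (p * N) <
      ((univ.filter fun x => (Gr ω).Adj v x).card : ℝ) then 1 else 0
  let f2 : V × (Fin (m - 1) → V) → (Sym2 V → Bool) → ℝ := fun z ω => if
      ((univ.filter fun x => ∃ i, inBall (Gr ω) z.1 (i.1 + 1) (z.2 i) x).card : ℝ) ≤ M ∧
      C * p * M ≤ ((univ.filter fun x => (Gr ω).Adj z.1 x ∧
        ∃ i, inBall (Gr ω) z.1 (i.1 + 1) (z.2 i) x).card : ℝ) then 1 else 0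
  let f3 : Finset V → (Sym2 V → Bool) → ℝ := fun S ω =>
    if (edgesIn (Gr ω) S : ℝ) < C * p * M * a then 1 else 0
  have n1 : ∀ z ω, 0 ≤ f1 z ω := by intro z ω; simp only [f1]; split_ifs <;> norm_num
  have n2 : ∀ z ω, 0 ≤ f2 z ω := by intro z ω; simp only [f2]; split_ifs <;> norm_num
  have n3 : ∀ z ω, 0 ≤ f3 z ω := by intro z ω; simp only [f3]; split_ifs <;> norm_num
  have e1 : Ex p (fun ω => ∑ v, f1 v ω) < 1 / 3 := by
    rw [Ex_sum]
    refine lt_of_le_of_lt (Finset.sum_le_sum fun v _ => prob_deg c p hc0 hc1 hp0 hp1 N hV v) ?_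
    rw [Finset.sum_const, Finset.card_univ, hV, nsmul_eq_mul]
    exact h1
  have e2 : Ex p (fun ω => ∑ z, f2 z ω) < 1 / 3 := by
    rw [Ex_sum]
    refine lt_of_le_of_lt (Finset.sum_le_sum fun z _ =>
      prob_ball p C M hp0 hp1 hC m z.1 z.2) ?_
    rw [Finset.sum_const, Finset.card_univ, nsmul_eq_mul, Fintype.card_prod, Fintype.card_fun, hV,
      Fintype.card_fin, ← pow_succ', Nat.sub_add_cancel hm]
    push_cast
    exact h2
  have e3 : Ex p (fun ω => ∑ S ∈ powersetCard a univ, f3 S ω) < 1 / 3 := by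
    rw [Ex_sum]
    refine lt_of_le_of_lt (Finset.sum_le_sum fun S hS =>
      prob_edges c p (C * p * M) hc0 hc1 hp0 hp1 a ha S (Finset.mem_powersetCard.mp hS).2) ?_
    rw [Finset.sum_const, Finset.card_powersetCard, Finset.card_univ, hV, nsmul_eq_mul]
    exact h3
  obtain ⟨ω, hω⟩ : ∃ ω, (∑ v, f1 v ω + ∑ z, f2 z ω) + ∑ S ∈ powersetCard a univ, f3 S ω < 1 := by
    by_contra hcon
    push Not at hcon
    have := Ex_mono hp0.le hp1 hcon
    rw [Ex_one, Ex_add, Ex_add] at this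
    linarith
  have s1 : 0 ≤ ∑ v, f1 v ω := Finset.sum_nonneg fun v _ => n1 v ω
  have s2 : 0 ≤ ∑ v, f2 v ω := Finset.sum_nonneg fun v _ => n2 v ω
  have s3 : 0 ≤ ∑ S ∈ powersetCard a univ, f3 S ω := Finset.sum_nonneg fun v _ => n3 v ω
  have hdeg : ∀ v, ((univ.filter fun x => (Gr ω).Adj v x).card : ℝ) ≤ (1 + c) * (p * N) := by
    intro v
    by_contra hcon
    have h := Finset.single_le_sum (f := fun v => f1 v ω) (fun v _ => n1 v ω) (mem_univ v)
    have : f1 v ω = 1 := if_pos (not_le.mp hcon)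
    simp only [this] at h
    linarith
  refine ⟨Gr ω, ?_, ?_⟩
  · intro u w
    by_contra hcon
    have h := Finset.single_le_sum (f := fun v => f2 v ω) (fun v _ => n2 v ω) (mem_univ (u, w))
    have : f2 (u, w) ω = 1 := by
      apply if_pos
      refine ⟨?_, not_lt.mp hcon⟩
      rw [hM]
      exact union_card (Gr ω) c _ hc0 hq hdeg u m w
    simp only [this] at h
    linarith
  · intro A hA
    by_contra hcon
    have h := Finset.single_le_sum (f := fun v => f3 v ω) (fun v _ => n3 v ω)
      (Finset.mem_powersetCard.mpr ⟨Finset.subset_univ A, hA⟩)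
    have : f3 A ω = 1 := if_pos (not_le.mp hcon)
    simp only [this] at h
    linarith

theorem num_Y (k : ℕ) (hk : 1 ≤ k) (N c p C : ℝ) (hc0 : 0 < c) (hc1 : c < 1) (hp0 : 0 < p)
    (hC : 1 < C) (hN : 0 < N) (hY : 1 ≤ Real.log N)
    (h2 : (k+1) * Real.log N < (1 - C + C * Real.log C) * (p * ((1+c)^(k+2) * (p*N)^k)))
    (h4 : (k+1) * (2 * C * ((1+c)^(k+2) * (p*N)^k) / (1-c)) < N) :
    Real.log (2*(k+1)) + k * (1 + Real.log 2 + 2 * Real.log (k+1)) ≤ Real.log N ∧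
      (k:ℝ) + 1 ≤ Real.log N := by
  have hkr : (1:ℝ) ≤ k := by exact_mod_cast hk
  set M : ℝ := (1+c)^(k+2) * (p*N)^k with hM
  set Y := Real.log N with hYd
  set t := Real.log C with ht
  have hx : 0 < p * N := by positivity
  have ht0 : 0 < t := Real.log_pos hC
  have hM0 : 0 < M := by positivity
  have hMx : (p*N)^k ≤ M := by
    rw [hM]
    have : (1:ℝ) ≤ (1+c)^(k+2) := one_le_pow₀ (by linarith)
    have h' : 0 < (p*N)^k := by positivity
    nlinarith
  have hA : (k+1) * (2 * C * M) < N := by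
    refine lt_of_le_of_lt ?_ h4
    apply mul_le_mul_of_nonneg_left _ (by positivity)
    rw [le_div_iff₀ (by linarith)]
    have : 0 < 2 * C * M := by positivity
    nlinarith
  have hB : (k+1) * Y < C * t * (p * M) := by
    refine lt_of_lt_of_le h2 ?_
    apply mul_le_mul_of_nonneg_right _ (by positivity)
    linarith
  have hE : 2 * (k+1)^2 * Y < t * (p * N) := by
    have e1 : t * (p * ((k+1) * (2 * C * M))) ≤ t * (p * N) := by gcongr
    have e2 : 2 * (k+1) * ((k+1) * Y) < 2 * (k+1) * (C * t * (p * M)) := by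
      apply mul_lt_mul_of_pos_left hB; positivity
    calc _ = 2 * (k+1) * ((k+1) * Y) := by ring
      _ < _ := e2
      _ = t * (p * ((k+1) * (2 * C * M))) := by ring
      _ ≤ _ := e1
  have hF : 2 * (k+1) * C * (p*N)^k < N := by
    refine lt_of_le_of_lt ?_ hA
    have : 2 * (k+1) * C * (p*N)^k ≤ 2 * (k+1) * C * M := by gcongr
    linarith
  have lF : Real.log (2*(k+1)) + t + k * Real.log (p*N) ≤ Y := by
    have := Real.log_le_log (by positivity) hF.le
    rw [Real.log_mul (by positivity) (by positivity), Real.log_mul (by positivity) (by positivity),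
      Real.log_pow] at this
    exact this
  have lE : Real.log 2 + 2 * Real.log (k+1) + Real.log Y ≤ Real.log t + Real.log (p*N) := by
    have := Real.log_le_log (by positivity) hE.le
    rw [Real.log_mul (by positivity) (by positivity), Real.log_mul (by positivity) (by positivity),
      Real.log_mul (by positivity) (by positivity), Real.log_pow] at this
    exact_mod_cast this
  have lt' : k * (Real.log t - Real.log k) ≤ t - k := by
    have := Real.log_le_sub_one_of_pos (show 0 < t / k by positivity)
    rw [Real.log_div (by positivity) (by positivity)] at this
    have h' := mul_le_mul_of_nonneg_left this (show (0:ℝ) ≤ k by positivity)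
    have : (k:ℝ) * (t / k - 1) = t - k := by field_simp
    linarith
  have lk : Real.log k ≤ Real.log (k+1) := Real.log_le_log (by positivity) (by linarith)
  have lE' := mul_le_mul_of_nonneg_left lE (show (0:ℝ) ≤ k by positivity)
  have lk' := mul_le_mul_of_nonneg_left lk (show (0:ℝ) ≤ k by positivity)
  have key : Real.log (2*(k+1)) + k * (1 + Real.log 2 + Real.log (k+1) + Real.log Y) ≤ Y := by
    linarith
  have l2 : 0 ≤ Real.log 2 := Real.log_nonneg (by norm_num)
  have lk1 : 0 ≤ Real.log ((k:ℝ)+1) := Real.log_nonneg (by linarith)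
  have lY : 0 ≤ Real.log Y := Real.log_nonneg hY
  have l4 : 1 ≤ Real.log (2*((k:ℝ)+1)) := by
    rw [Real.le_log_iff_exp_le (by positivity)]
    have := Real.exp_one_lt_d9
    linarith
  have hkY : (k:ℝ)+1 ≤ Y := by
    have : 0 ≤ (k:ℝ) * (Real.log 2 + Real.log (k+1) + Real.log Y) := by positivity
    linarith
  refine ⟨?_, hkY⟩
  have : Real.log ((k:ℝ)+1) ≤ Real.log Y := Real.log_le_log (by positivity) hkY
  have := mul_le_mul_of_nonneg_left this (show (0:ℝ) ≤ k by positivity)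
  linarith

theorem num_ivt (k : ℕ) (hk : 1 ≤ k) (N c p C : ℝ) (hc0 : 0 < c) (hc1 : c < 1) (hp1 : p < 1)
    (hC : 1 < C) (hN : 1 ≤ N)
    (h4 : (k+1) * (2 * C * ((1+c)^(k+2) * (p*N)^k) / (1-c) + 1) < N) :
    ∃ q, p ≤ q ∧ q ≤ 1 ∧ (k+1) * (2 * C * ((1+c)^(k+2) * (q*N)^k) / (1-c) + 1) = N := by
  have hcont : ContinuousOn
      (fun q : ℝ => ((k:ℝ)+1) * (2 * C * ((1+c)^(k+2) * (q*N)^k) / (1-c) + 1)) (Set.Icc p 1) := by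
    fun_prop
  have hkr : (1:ℝ) ≤ k := by exact_mod_cast hk
  have h1 : N ≤ ((k:ℝ)+1) * (2 * C * ((1+c)^(k+2) * (1*N)^k) / (1-c) + 1) := by
    have a1 : N ≤ N^k := le_self_pow₀ hN (by omega)
    have a2 : (1:ℝ) ≤ (1+c)^(k+2) := one_le_pow₀ (by linarith)
    have a3 : N ≤ 2 * C * ((1+c)^(k+2) * (1*N)^k) / (1-c) := by
      rw [le_div_iff₀ (by linarith), one_mul]
      have : N ≤ (1+c)^(k+2) * N^k := by nlinarith
      nlinarith
    nlinarith
  obtain ⟨q, hq, hq'⟩ := intermediate_value_Icc hp1.le hcont ⟨h4.le, h1⟩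
  exact ⟨q, hq.1, hq.2, hq'⟩

theorem num_h3 (k : ℕ) (hk : 1 ≤ k) (N a : ℕ) (R c q : ℝ) (hR : 18 ≤ R)
    (hN : ((k:ℝ)+1) * (R+1) = N) (haR : R + 1 ≤ a) 
    (h1 : 3 * Real.log (3*N) < c^2*q*N)
    (hY : Real.log (2*((k:ℝ)+1)) + k * (1 + Real.log 2 + 2 * Real.log (k+1)) ≤ Real.log N) :
    (N.choose a : ℝ) * Real.exp (-(c^2*q*a*(a-1)/4)) < 1/3 := by
  have hkr : (1:ℝ) ≤ k := by exact_mod_cast hk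
  have ha0 : (0:ℝ) < a := by linarith
  have hN0 : (0:ℝ) < N := by rw [← hN]; positivity
  have c1 : (N.choose a : ℝ) ≤ Real.exp (a * (1 + Real.log (k+1))) := by
    have e1 : (N.choose a : ℝ) ≤ (N:ℝ)^a / (a.factorial : ℝ) := Nat.choose_le_pow_div a N
    have e2 : (a:ℝ)^a / (a.factorial : ℝ) ≤ Real.exp a := Real.pow_div_factorial_le_exp _ ha0.le a
    have e3 : (N:ℝ)^a ≤ (k+1)^a * (a:ℝ)^a := by
      rw [← mul_pow]
      apply pow_le_pow_left₀ hN0.le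
      rw [← hN]; gcongr
    have e4 : ((k:ℝ)+1)^a = Real.exp (a * Real.log (k+1)) := by
      rw [mul_comm, Real.exp_mul, Real.exp_log (by positivity), Real.rpow_natCast]
    calc _ ≤ _ := e1
      _ ≤ (k+1)^a * (a:ℝ)^a / (a.factorial : ℝ) := by gcongr
      _ = (k+1)^a * ((a:ℝ)^a / (a.factorial : ℝ)) := by ring
      _ ≤ (k+1)^a * Real.exp a := by gcongr
      _ = _ := by rw [e4, ← Real.exp_add]; ring_nf
  refine lt_of_le_of_lt (mul_le_mul_of_nonneg_right c1 (Real.exp_nonneg _)) ?_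
  rw [← Real.exp_add, show (1/3:ℝ) = Real.exp (-Real.log 3) by
    rw [Real.exp_neg, Real.exp_log (by norm_num)]; norm_num]
  apply Real.exp_lt_exp.2
  set l := Real.log ((k:ℝ)+1) with hl
  have hl0 : 0 ≤ l := Real.log_nonneg (by linarith)
  have L2 := Real.log_two_gt_d9
  have L3 : Real.log 3 < 1.1 := by
    rw [Real.log_lt_iff_lt_exp (by norm_num)]
    have h1 := Real.sum_le_exp_of_nonneg (show (0:ℝ) ≤ 1.1 by norm_num) 6
    norm_num [Finset.sum_range_succ, Nat.factorial] at h1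
    linarith
  have L3' : 1 < Real.log 3 := by
    rw [Real.lt_log_iff_exp_lt (by norm_num)]
    have := Real.exp_one_lt_d9
    linarith
  have hZ : Real.log (3*N) = Real.log 3 + Real.log N := Real.log_mul (by norm_num) (by positivity)
  have hZ2 : Real.log (2*((k:ℝ)+1)) = Real.log 2 + l := Real.log_mul (by norm_num) (by positivity)
  rw [hZ2] at hY
  set Z := Real.log (3*N) with hZd
  -- main inequality
  have main : ((k:ℝ)+1) * (1 + l + 0.062) < 54/76 * Z := by
    have e : 0 ≤ ((k:ℝ) - 1) * l := mul_nonneg (by linarith) hl0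
    have e2 : 0 ≤ (k:ℝ) * (Real.log 2 - 0.69) := mul_nonneg (by linarith) (by linarith)
    nlinarith
  have hcq : 0 < c^2*q := by
    have hz : 0 < Z := by
      rw [hZd]; apply Real.log_pos
      rw [← hN]; nlinarith
    by_contra hh
    push Not at hh
    nlinarith
  have f1 : c^2*q*N*(18/19) ≤ (k+1) * (c^2*q*R) := by
    rw [← hN]
    have : (R+1)*(18/19) ≤ R := by linarith
    have := mul_le_mul_of_nonneg_left this (show 0 ≤ c^2*q*((k:ℝ)+1) by positivity)
    linarith
  have f2 : 1 + l + 0.062 < c^2*q*R/4 := by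
    have : ((k:ℝ)+1) * (1 + l + 0.062) < (k+1) * (c^2*q*R/4) := by linarith
    exact lt_of_mul_lt_mul_left this (by positivity)
  have f3 : c^2*q*R/4 ≤ c^2*q*(a-1)/4 := by
    have : R ≤ (a:ℝ) - 1 := by linarith
    gcongr
  have f4 : (a:ℝ) * (1 + l + 0.062) < a * (c^2*q*(a-1)/4) :=
    mul_lt_mul_of_pos_left (lt_of_lt_of_le f2 f3) ha0
  have f5 : (a:ℝ) * 0.062 ≥ 19*0.062 := by nlinarith
  linarith

theorem combine {V : Type*} [Fintype V] (c p C M : ℝ) (hc0 : 0 < c) (hc1 : c < 1)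
    (hp0 : 0 < p) (hp1 : p ≤ 1) (hC : 1 < C) (N : ℕ) (hV : Fintype.card V = N) (m a : ℕ)
    (hm : 1 ≤ m) (hM : M = (1+c)^2 * ((1+c)*(p*N))^(m-1)) (hq : 1 + c ≤ c*((1+c)*(p*N)))
    (ha1 : 1 ≤ a)
    (ha : C*p*M ≤ (1-c)*p*((a:ℝ)-1)/2)
    (h1 : N * Real.exp (-(c^2*p*N/3)) < 1/3)
    (h2 : (N:ℝ)^m * Real.exp (-((1 - C + C*Real.log C)*p*M)) < 1/3)
    (h3 : (N.choose a : ℝ) * Real.exp (-(c^2*p*a*(a-1)/4)) < 1/3)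
    (h4 : m * (a - 1) < N) :
    ∃ G : SimpleGraph V, IsoRamseyArrowTrees G (m + 1) := by
  classical
  obtain ⟨G, H1, H2⟩ := prob_main (V := V) c p C M hc0 hc1 hp0 hp1 hC N hV m a hm hM hq ha h1 h2 h3
  refine ⟨G, det_main G m a ha1 (C*p*M) ?_ ?_ (by rw [hV]; exact h4)⟩
  · intro u w
    convert H1 u w
  · intro A hA
    exact H2 A hA

set_option maxHeartbeats 2000000 in
theorem big_case (k N : ℕ) (hk : 1 ≤ k) (hN : 1 ≤ N) (c p C : ℝ) (hc0 : 0 < c) (hc1 : c < 1)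
    (hp0 : 0 < p) (hp1 : p < 1) (hC : 1 < C)
    (h1 : c ^ 2 * p * N > 3 * Real.log (3 * N))
    (h2 : (1 - C + C * Real.log C) * (p * ((1 + c) ^ (k+2) * (p * N) ^ k)) >
        ((k : ℝ) + 1) * Real.log N + Real.log (1 + c) + Real.log 3)
    (h4 : ((k : ℝ) + 1) * k / ((1 - c) * p) +
        (k + 1) * (2 * C * ((1 + c) ^ (k+2) * (p * N) ^ k) / (1 - c)) < N) :
    ∃ G : SimpleGraph (Fin N), IsoRamseyArrowTrees G (k + 2) := by
  have hkr : (1:ℝ) ≤ k := by exact_mod_cast hk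
  have hNr : (1:ℝ) ≤ N := by exact_mod_cast hN
  have hN0 : (0:ℝ) < N := by linarith
  have L3' : 1 < Real.log 3 := by
    rw [Real.lt_log_iff_exp_lt (by norm_num)]
    have := Real.exp_one_lt_d9
    linarith
  have hZ : Real.log (3*N) = Real.log 3 + Real.log N := Real.log_mul (by norm_num) (by positivity)
  have hY0 : 0 ≤ Real.log N := Real.log_nonneg hNr
  have hc2 : c^2 < 1 := by nlinarith
  have hlc : 0 < Real.log (1+c) := Real.log_pos (by linarith)
  have hY1 : 1 ≤ Real.log N := by
    rw [Real.le_log_iff_exp_le hN0]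
    have e1 : c^2*p*N ≤ N := by
      have : c^2 * p ≤ 1 := by nlinarith
      nlinarith
    have := Real.exp_one_lt_d9
    linarith
  have hM0 : 0 < (1 + c) ^ (k+2) * (p * N) ^ k := by positivity
  have h1c : 0 < 1 - c := by linarith
  have g1 : (k:ℝ) + 1 ≤ ((k : ℝ) + 1) * k / ((1 - c) * p) := by
    rw [le_div_iff₀ (by positivity)]
    have : (1-c)*p ≤ k := by nlinarith
    gcongr
  obtain ⟨hY, hkY⟩ := num_Y k hk N c p C hc0 hc1 hp0 hC hN0 hY1 (by linarith) (by linarith)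
  obtain ⟨q, hpq, hq1, hq⟩ := num_ivt k hk N c p C hc0 hc1 hp1 hC hNr (by linarith)
  have hq0 : 0 < q := by linarith
  have hL : 0 < 1 - C + C * Real.log C := by
    by_contra hh
    push Not at hh
    have : (1 - C + C * Real.log C) * (p * ((1 + c) ^ (k+2) * (p * N) ^ k)) ≤ 0 :=
      mul_nonpos_of_nonpos_of_nonneg hh (by positivity)
    have : 0 ≤ ((k : ℝ) + 1) * Real.log N := by positivity
    linarith
  have h1' : 3 * Real.log (3*N) < c^2*q*N := by
    refine lt_of_lt_of_le h1 ?_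
    gcongr
  have h2' : ((k : ℝ) + 1) * Real.log N + Real.log (1 + c) + Real.log 3 <
      (1 - C + C * Real.log C) * (q * ((1 + c) ^ (k+2) * (q * N) ^ k)) := by
    refine lt_of_lt_of_le h2 ?_
    gcongr
  set M : ℝ := (1 + c) ^ (k+2) * (q * N) ^ k with hM
  set R : ℝ := 2 * C * M / (1-c) with hR
  have hqN : 9 ≤ q * N := by
    have : c^2 * (q * N) ≤ q * N := by
      have : 0 < q * N := by positivity
      nlinarith
    linarith
  have hMq : q * N ≤ M := by
    have a1 : q * N ≤ (q * N)^k := le_self_pow₀ (by linarith) (by omega)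
    have a2 : (1:ℝ) ≤ (1+c)^(k+2) := one_le_pow₀ (by linarith)
    rw [hM]; nlinarith
  have hR18 : 18 ≤ R := by
    rw [hR, le_div_iff₀ h1c]
    nlinarith
  set a : ℕ := ⌈R⌉₊ + 1 with ha
  have haR : R + 1 ≤ a := by
    rw [ha]; push_cast
    linarith [Nat.le_ceil R]
  have haR2 : (⌈R⌉₊:ℝ) < R + 1 := Nat.ceil_lt_add_one (by linarith)
  refine combine c q C M hc0 hc1 hq0 hq1 hC N (by simp) (k+1) a (by omega) ?_ ?_ (by omega) ?_ ?_ ?_ ?_ ?_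
  · rw [hM, Nat.add_sub_cancel, mul_pow (1+c) (q*N) k]; ring
  · have : 1 ≤ c * (q*N) := by
      have : c^2 * (q*N) ≤ c * (q*N) := by
        have : c^2 ≤ c := by rw [pow_two]; exact mul_le_of_le_one_left hc0.le hc1.le
        gcongr
      linarith
    nlinarith
  · have : C * M = (1-c) * R / 2 := by rw [hR]; field_simp
    have e : R ≤ (a:ℝ) - 1 := by linarith
    calc C*q*M = q * (C * M) := by ring
      _ = (1-c)*q*R/2 := by rw [this]; ring
      _ ≤ _ := by gcongr
  · have : Real.exp (-(c^2*q*N/3)) < Real.exp (-Real.log (3*N)) := Real.exp_lt_exp.2 (by linarith)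
    rw [Real.exp_neg (Real.log _), Real.exp_log (by positivity)] at this
    calc _ < (N:ℝ) * (3*(N:ℝ))⁻¹ := mul_lt_mul_of_pos_left this hN0
      _ = 1/3 := by field_simp
  · have e : Real.exp (-((1 - C + C*Real.log C)*q*M)) <
        Real.exp (-(((k:ℝ)+1) * Real.log N) + -Real.log 3) := Real.exp_lt_exp.2 (by linarith)
    have e' : Real.exp (-(((k:ℝ)+1) * Real.log N) + -Real.log 3) = ((N:ℝ)^(k+1))⁻¹ * 3⁻¹ := by
      rw [Real.exp_add, Real.exp_neg (Real.log 3), Real.exp_log (by norm_num)]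
      congr 1
      rw [Real.exp_neg]
      congr 1
      have := Real.exp_nat_mul (Real.log N) (k+1)
      rw [Real.exp_log hN0] at this
      rw [← this]
      push_cast
      rfl
    rw [e'] at e
    calc _ < (N:ℝ)^(k+1) * (((N:ℝ)^(k+1))⁻¹ * 3⁻¹) := mul_lt_mul_of_pos_left e (by positivity)
      _ = 1/3 := by field_simp
  · exact num_h3 k hk N a R c q hR18 hq haR h1' hY
  · rw [ha, Nat.add_sub_cancel]
    have : ((k:ℝ)+1) * (⌈R⌉₊:ℝ) < N := by
      rw [← hq]; gcongr
    exact_mod_cast this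

theorem stmt10 (n N : ℕ) (hn : 1 ≤ n) (hN : 1 ≤ N)
    (h : ∃ (c p C : ℝ), 0 < c ∧ c < 1 ∧ 0 < p ∧ p < 1 ∧ 1 < C ∧
      (c ^ 2 * p * N > 3 * Real.log (3 * N)) ∧
      ((1 - C + C * Real.log C) * p * (1 + c) ^ n * (p * N) ^ (n - 2) >
        ((n : ℝ) - 1) * Real.log N + Real.log (1 + c) + Real.log 3) ∧
      (c ^ 2 * C ^ 2 * (1 + c) ^ (2 * n) * (p * N) ^ (2 * n - 4) >
        N * Real.log 2 + Real.log (3 * n)) ∧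
      (((n : ℝ) - 1) * ((n : ℝ) - 2) / ((1 - c) * p) +
        (2 * C / (1 - c)) * ((n : ℝ) - 1) * (1 + c) ^ n * (p * N) ^ (n - 2) < N)) :
    ∃ (V : Type) (_ : Fintype V) (G : SimpleGraph V),
      Fintype.card V = N ∧ IsoRamseyArrowTrees G n := by

  obtain ⟨c, p, C, hc0, hc1, hp0, hp1, hC, h1, h2, -, h4⟩ := h
  refine ⟨Fin N, inferInstance, ?_⟩
  suffices hs : ∃ G : SimpleGraph (Fin N), IsoRamseyArrowTrees G n by
    obtain ⟨G, hG⟩ := hs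
    exact ⟨G, by simp, hG⟩
  rcases Nat.lt_or_ge n 3 with h3 | h3
  · refine ⟨⊤, small_case _ (fun x y hxy => by simpa using hxy) n N (by simp) ?_⟩
    have : n = 1 ∨ n = 2 := by omega
    rcases this with rfl | rfl
    · exact Or.inl ⟨rfl, hN⟩
    · refine Or.inr ⟨rfl, ?_⟩
      norm_num at h4
      have e : (2:ℝ) ≤ 2 * C / (1-c) := by
        rw [le_div_iff₀ (by linarith)]; nlinarith
      have e2 : (1:ℝ) ≤ (1+c)^2 := by nlinarith
      have : (2:ℝ) < N := by nlinarith
      have : 2 < N := by exact_mod_cast this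
      omega
  · obtain ⟨k, rfl⟩ : ∃ k, n = k + 2 := ⟨n - 2, by omega⟩
    refine big_case k N (by omega) hN c p C hc0 hc1 hp0 hp1 hC h1 ?_ ?_
    · rw [Nat.add_sub_cancel] at h2
      push_cast at h2
      have e : ((k:ℝ) + 2 - 1) = k + 1 := by ring
      rw [e] at h2
      linarith
    · rw [Nat.add_sub_cancel] at h4
      push_cast at h4
      have e : ((k:ℝ) + 2 - 1) = k + 1 := by ring
      have e' : ((k:ℝ) + 2 - 2) = k := by ring
      rw [e, e'] at h4
      refine lt_of_eq_of_lt ?_ h4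
      ring
end
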